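/- Let n = 2r be an integer divisible by 4 and let F be a field with char F = 0 or char F > r. Then the coordinate ring F[W] is an integral domain. -/

import Mathlib

open scoped Matrix

noncomputable section

namespace PR

/-- The polynomial ring `R[Y_{ij} : 1 ≤ i, j ≤ n]`, `n = 2r`. -/
abbrev PolyRing (r : ℕ) (R : Type*) [CommRing R] :=
  MvPolynomial (Fin (2 * r) × Fin (2 * r)) R

/-- The standard symplectic form matrix `J` (`n = 2r`). -/
def Jmat (r : ℕ) (R : Type*) [CommRing R] : Matrix (Fin (2 * r)) (Fin (2 * r)) R :=
  Matrix.of fun i j =>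
    if (j : ℕ) = (i : ℕ) + r then 1 else if (i : ℕ) = (j : ℕ) + r then -1 else 0

/-- The generic `n × n` matrix of indeterminates. -/
def Ygen (r : ℕ) (R : Type*) [CommRing R] :
    Matrix (Fin (2 * r)) (Fin (2 * r)) (MvPolynomial (Fin (2 * r) × Fin (2 * r)) R) :=
  Matrix.of fun i j => MvPolynomial.X (i, j)

/-- The defining ideal of the scheme `V`. -/
def VIdeal (r : ℕ) (R : Type*) [CommRing R] :
    Ideal (MvPolynomial (Fin (2 * r) × Fin (2 * r)) R) :=
  Ideal.span
    ({p | ∃ i j, p = (Ygen r R + (Ygen r R)ᵀ) i j} ∪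
     {p | ∃ i, p = Ygen r R i i} ∪
     {p | ∃ i j, p = ((Ygen r R)ᵀ * Jmat r (PolyRing r R) * Ygen r R) i j} ∪
     {p | ∃ k, p = (Matrix.charpoly (-(Jmat r (PolyRing r R) * Ygen r R)) - Polynomial.X ^ (2 * r)).coeff k})

/-- The coordinate ring `R[V]`. -/
abbrev FV (r : ℕ) (R : Type*) [CommRing R] :=
  MvPolynomial (Fin (2 * r) × Fin (2 * r)) R ⧸ VIdeal r R

/-- The pfaffian of an `m × m` matrix (nonzero only for even `m`), defined as a signed sum over
permutations `σ` with `σ(2i-1) < σ(2i)` for each pair and `σ(1) < σ(3) < ⋯` (here 0-indexed). -/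
def pf {m : ℕ} {R : Type*} [CommRing R] (A : Matrix (Fin m) (Fin m) R) : R :=
  ∑ σ ∈ Finset.univ.filter (fun σ : Equiv.Perm (Fin m) =>
      (∀ i : Fin (m / 2),
        σ ⟨2 * i.val, by have := i.isLt; omega⟩ < σ ⟨2 * i.val + 1, by have := i.isLt; omega⟩) ∧
      ∀ i j : Fin (m / 2), i < j →
        σ ⟨2 * i.val, by have := i.isLt; omega⟩ < σ ⟨2 * j.val, by have := j.isLt; omega⟩),
    (Equiv.Perm.sign σ : ℤ) •
      ∏ i : Fin (m / 2),
        A (σ ⟨2 * i.val, by have := i.isLt; omega⟩) (σ ⟨2 * i.val + 1, by have := i.isLt; omega⟩)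

/-- `[i₁, …, i₂ₗ]`: the pfaffian of the submatrix of `Y` given by a list of indices. -/
def listPf {n : ℕ} {R : Type*} [CommRing R] (Y : Matrix (Fin n) (Fin n) R)
    (L : List (Fin n)) : R :=
  pf (Matrix.of fun a b : Fin L.length => Y (L.get a) (L.get b))

/-- The product of pfaffians associated to a tableau (rows as lists of entries),
as a polynomial. -/
def tabPoly (r : ℕ) (R : Type*) [CommRing R] (T : List (List (Fin (2 * r)))) :
    MvPolynomial (Fin (2 * r) × Fin (2 * r)) R :=
  (T.map (listPf (Ygen r R))).prod

/-- `[T]`, the class of the product of pfaffians of the rows of `T` in `R[V]`. -/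
def tabElem (r : ℕ) (R : Type*) [CommRing R] (T : List (List (Fin (2 * r)))) : FV r R :=
  Ideal.Quotient.mk (VIdeal r R) (tabPoly r R T)

/-- Position of an index in the order `1̄ ≺ 1 ≺ 2̄ ≺ 2 ≺ ⋯ ≺ r̄ ≺ r`, where `ī := r + i`
(0-indexed: `ī` is `r + i - 1` and `i` is `i - 1`). -/
def ordIdx (r : ℕ) (x : Fin (2 * r)) : ℕ :=
  if x.val < r then 2 * x.val + 1 else 2 * (x.val - r)

/-- A list of rows represents a tableau of shape a partition: row lengths weakly decreasing
and positive. -/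
def IsShape {α : Type*} (T : List (List α)) : Prop :=
  (T.map List.length).Chain' (fun a b => b ≤ a) ∧ ∀ row ∈ T, row ≠ []

/-- An even-tableau: every row has even length. -/
def IsEvenTab {α : Type*} (T : List (List α)) : Prop :=
  ∀ row ∈ T, Even row.length

/-- Standard: entries strictly increase along each row and weakly increase down each column,
with respect to the order `≺`. -/
def IsStandard (r : ℕ) (T : List (List (Fin (2 * r)))) : Prop :=
  (∀ row ∈ T, row.Chain' (fun a b => ordIdx r a < ordIdx r b)) ∧
  ∀ (i t : ℕ) (hi : i + 1 < T.length) (ht' : t < (T[i]'(Nat.lt_of_succ_lt hi)).length)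
    (ht : t < (T[i + 1]'hi).length),
    ordIdx r ((T[i]'(Nat.lt_of_succ_lt hi))[t]'ht') ≤ ordIdx r ((T[i + 1]'hi)[t]'ht)

/-- The symplectic condition: the entries `p` and `p̄` (0-indexed: values `p` and `r + p`
for `p < r`) occur only in the first `p + 1` columns (0-indexed: columns `t ≤ p`). -/
def IsSymplectic (r : ℕ) (T : List (List (Fin (2 * r)))) : Prop :=
  ∀ (i t : ℕ) (hi : i < T.length) (ht : t < (T[i]'hi).length) (p : ℕ), p < r →
    (((T[i]'hi)[t]'ht).val = p ∨ ((T[i]'hi)[t]'ht).val = r + p) → t ≤ p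

/-- A symplectic standard even-tableau. -/
def IsSSET (r : ℕ) (T : List (List (Fin (2 * r)))) : Prop :=
  IsShape T ∧ IsEvenTab T ∧ IsStandard r T ∧ IsSymplectic r T

/-- A canonical tableau: in column `j` only `j̄` appears (0-indexed: column `t` contains
only the value `r + t`). -/
def IsCanonical (r : ℕ) (T : List (List (Fin (2 * r)))) : Prop :=
  ∀ (i t : ℕ) (hi : i < T.length) (ht : t < (T[i]'hi).length), ((T[i]'hi)[t]'ht).val = r + t

/-- The set `V(C)` of matrices. -/
def MemV (r : ℕ) {C : Type*} [CommRing C] (Y : Matrix (Fin (2 * r)) (Fin (2 * r)) C) : Prop :=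
  Y = -Yᵀ ∧ (∀ i, Y i i = 0) ∧ Yᵀ * Jmat r C * Y = 0 ∧
    Matrix.charpoly (-(Jmat r C * Y)) = Polynomial.X ^ (2 * r)

/-- The embedding `i ↦ i` of `{1, …, r}` into `{1, …, n}`. -/
def emb (r : ℕ) (i : Fin r) : Fin (2 * r) := ⟨i.val, by have := i.isLt; omega⟩

/-- The embedding `i ↦ ī = r + i` of `{1, …, r}` into `{1, …, n}`. -/
def embBar (r : ℕ) (i : Fin r) : Fin (2 * r) := ⟨r + i.val, by have := i.isLt; omega⟩

/-- The index list of `[P, Q̄]`: with `Γ₀ = P ∩ Q = {γ₁ < ⋯ < γ_λ}`, the list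
`γ₁, γ̄₁, …, γ_λ, γ̄_λ` followed by `P ∖ Γ₀` in increasing order and then the bars of
`Q ∖ Γ₀` in increasing order. -/
def pqList (r : ℕ) (P Q : Finset (Fin r)) : List (Fin (2 * r)) :=
  ((P ∩ Q).sort (· ≤ ·)).flatMap (fun γ => [emb r γ, embBar r γ]) ++
    ((P \ Q).sort (· ≤ ·)).map (emb r) ++ ((Q \ P).sort (· ≤ ·)).map (embBar r)

/-- The pfaffian `[P, Q̄]` of the matrix `Y`. -/
def pfPQ (r : ℕ) {C : Type*} [CommRing C] (Y : Matrix (Fin (2 * r)) (Fin (2 * r)) C)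
    (P Q : Finset (Fin r)) : C :=
  listPf Y (pqList r P Q)

/-- The defining ideal of the scheme `W`. -/
def WIdeal (r : ℕ) (R : Type*) [CommRing R] : Ideal (PolyRing r R) :=
  Ideal.span
    ({p | ∃ i j, p = (Jmat r (PolyRing r R) * (Ygen r R)ᵀ * Jmat r (PolyRing r R)
            + Ygen r R) i j} ∪
     {p | ∃ i j, p = (Ygen r R * Ygen r R) i j} ∪
     {p | ∃ k, p = (Matrix.charpoly (Ygen r R) - Polynomial.X ^ (2 * r)).coeff k})

/-- The coordinate ring `R[W]`. -/
abbrev FW (r : ℕ) (R : Type*) [CommRing R] := PolyRing r R ⧸ WIdeal r R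

section SlotPf

variable {R S U V : Type*} [CommRing R] [CommRing S] [Fintype U] [DecidableEq U]
  [Fintype V] [DecidableEq V]

/-- The signed sum over all arrangements of the letters `K` in the pairs of slots `U × Fin 2`.
For a skew matrix `A` it is `2 ^ s * s!` times a pfaffian, where `s` is the size of `U`. -/
def slotPf (A : ℕ → ℕ → R) (K : U × Fin 2 → ℕ) : R :=
  ∑ σ : Equiv.Perm (U × Fin 2),
    ((Equiv.Perm.sign σ : ℤ) : R) * ∏ u, A (K (σ (u, 0))) (K (σ (u, 1)))

lemma slotPf_map (f : R →+* S) (A : ℕ → ℕ → R) (K : U × Fin 2 → ℕ) :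
    f (slotPf A K) = slotPf (fun i j => f (A i j)) K := by
  simp [slotPf, map_sum, map_prod]

lemma slotPf_comp_perm (A : ℕ → ℕ → R) (K : U × Fin 2 → ℕ) (τ : Equiv.Perm (U × Fin 2)) :
    slotPf A (K ∘ τ) = ((Equiv.Perm.sign τ : ℤ) : R) * slotPf A K := by
  unfold slotPf
  rw [Finset.mul_sum, ← Equiv.sum_comp (Equiv.mulLeft τ) (fun σ => ((Equiv.Perm.sign τ : ℤ) : R) *
    (((Equiv.Perm.sign σ : ℤ) : R) * ∏ u, A (K (σ (u, 0))) (K (σ (u, 1)))))]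
  refine Finset.sum_congr rfl fun σ _ => ?_
  have h : ((Equiv.Perm.sign τ : ℤ) : R) * ((Equiv.Perm.sign τ : ℤ) : R) = 1 := by
    rcases Int.units_eq_one_or (Equiv.Perm.sign τ) with h | h <;> simp [h]
  simp only [Equiv.coe_mulLeft, Equiv.Perm.sign_mul, Units.val_mul, Int.cast_mul,
    Function.comp_apply, Equiv.Perm.mul_apply]
  rw [← mul_assoc, ← mul_assoc, h, one_mul]

lemma slotPf_reindex (A : ℕ → ℕ → R) (K : V × Fin 2 → ℕ) (e : U ≃ V) :
    slotPf A (fun p : U × Fin 2 => K (e p.1, p.2)) = slotPf A K := by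
  unfold slotPf
  let E : U × Fin 2 ≃ V × Fin 2 := e.prodCongr (Equiv.refl _)
  rw [← Equiv.sum_comp (Equiv.permCongr E)]
  refine Finset.sum_congr rfl fun σ _ => ?_
  rw [Equiv.Perm.sign_permCongr, ← Equiv.prod_comp e]
  simp [E, Prod.map]

lemma slotPf_eq_zero (A : ℕ → ℕ → R) (K : U × Fin 2 → ℕ) (hK : ¬ Function.Injective K) :
    slotPf A K = 0 := by
  obtain ⟨p, q, h, hne⟩ : ∃ p q, K p = K q ∧ p ≠ q := by
    simpa only [Function.Injective, not_forall, exists_prop] using hK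
  have hs : ∀ x, K (Equiv.swap p q x) = K x := by
    intro x
    rcases eq_or_ne x p with rfl | hx
    · simp [h]
    rcases eq_or_ne x q with rfl | hx'
    · simp [h]
    rw [Equiv.swap_apply_of_ne_of_ne hx hx']
  refine Finset.sum_involution (fun σ _ => Equiv.swap p q * σ) ?_ ?_ ?_ ?_
  · intro σ _
    simp [Equiv.Perm.sign_mul, Equiv.Perm.sign_swap hne, hs]
  · intro σ _ _ h'
    rw [mul_eq_right, Equiv.swap_eq_one_iff] at h'
    exact hne h'
  · intros; simp
  · intro σ _
    simp [← mul_assoc]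

lemma slotPf_eq_or_neg (A : ℕ → ℕ → R) {K : U × Fin 2 → ℕ} {K' : V × Fin 2 → ℕ}
    (hK : Function.Injective K) (hK' : Function.Injective K')
    (h : Set.range K = Set.range K') :
    slotPf A K = slotPf A K' ∨ slotPf A K = - slotPf A K' := by
  let E : U × Fin 2 ≃ V × Fin 2 :=
    (Equiv.ofInjective K hK).trans ((Equiv.setCongr h).trans (Equiv.ofInjective K' hK').symm)
  have hE : ∀ x, K' (E x) = K x := by
    intro x
    have := Equiv.apply_ofInjective_symm hK' ((Equiv.setCongr h) (Equiv.ofInjective K hK x))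
    simpa [E] using this
  have hc : Fintype.card U = Fintype.card V := by
    have := Fintype.card_congr E
    simpa using this
  let e : U ≃ V := Fintype.equivOfCardEq hc
  rw [← slotPf_reindex A K' e]
  let τ : Equiv.Perm (U × Fin 2) := E.trans (e.prodCongr (Equiv.refl _)).symm
  have hτ : K = (fun p : U × Fin 2 => K' (e p.1, p.2)) ∘ τ := by
    funext x
    simp [τ, hE]
  rw [hτ, slotPf_comp_perm]
  rcases Int.units_eq_one_or (Equiv.Perm.sign τ) with h | h <;> simp [h]

end SlotPf

/-- `A` is a skew matrix with `A J A = 0` and vanishing half trace `∑ A_{l, l̄}`, where the letters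
`2 l` and `2 l + 1` are paired by `J`. -/
structure IsNullSkew {R : Type*} [CommRing R] (r : ℕ) (A : ℕ → ℕ → R) : Prop where
  skew : ∀ i j, A i j = - A j i
  diag : ∀ i, A i i = 0
  null : ∀ i j, ∑ l ∈ Finset.range r,
    (A i (2 * l) * A (2 * l + 1) j - A i (2 * l + 1) * A (2 * l) j) = 0
  trace : ∑ l ∈ Finset.range r, A (2 * l) (2 * l + 1) = 0

section Contraction

variable {R U : Type*}

/-- Adjoin to `K` a pair of slots filled by the letters `a` and `b`. -/
def consSlot (a b : ℕ) (K : U × Fin 2 → ℕ) : Option U × Fin 2 → ℕ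
  | (none, x) => if x = 0 then a else b
  | (some u, x) => K (u, x)

lemma consSlot_swap [DecidableEq U] (a b : ℕ) (K : U × Fin 2 → ℕ) (p : Option U × Fin 2) :
    consSlot a b K (Equiv.swap (none, 0) (none, 1) p) = consSlot b a K p := by
  obtain ⟨_ | u, x⟩ := p
  · fin_cases x <;> simp [consSlot]
  · rw [Equiv.swap_apply_of_ne_of_ne (by simp) (by simp)]
    simp [consSlot]

lemma consSlot_of_ne (a b a' b' : ℕ) (K : U × Fin 2 → ℕ) {p : Option U × Fin 2}
    (h0 : p ≠ (none, 0)) (h1 : p ≠ (none, 1)) : consSlot a b K p = consSlot a' b' K p := by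
  obtain ⟨_ | u, x⟩ := p
  · fin_cases x <;> simp_all
  · simp [consSlot]

variable [CommRing R] [Fintype U] [DecidableEq U]

lemma contraction_term {r : ℕ} {A : ℕ → ℕ → R} (hA : IsNullSkew r A) (K : U × Fin 2 → ℕ)
    (σ : Equiv.Perm (Option U × Fin 2)) :
    ∑ l ∈ Finset.range r,
      ((∏ u, A (consSlot (2 * l) (2 * l + 1) K (σ (u, 0)))
          (consSlot (2 * l) (2 * l + 1) K (σ (u, 1)))) -
        ∏ u, A (consSlot (2 * l + 1) (2 * l) K (σ (u, 0)))
          (consSlot (2 * l + 1) (2 * l) K (σ (u, 1)))) = 0 := by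
  obtain ⟨p, hp⟩ := σ.surjective (none, 0)
  obtain ⟨q, hq⟩ := σ.surjective (none, 1)
  obtain ⟨u₁, x₁⟩ := p
  obtain ⟨u₂, x₂⟩ := q
  have hx : ∀ a b, consSlot a b K (none, 0) = a := fun a b => by simp [consSlot]
  have hy : ∀ a b, consSlot a b K (none, 1) = b := fun a b => by simp [consSlot]
  have hne : ∀ z, z ≠ (u₁, x₁) → z ≠ (u₂, x₂) → ∀ a b,
      consSlot a b K (σ z) = consSlot 0 0 K (σ z) := by
    intro z h0 h1 a b
    refine consSlot_of_ne _ _ _ _ K (fun h => h0 ?_) (fun h => h1 ?_)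
    · exact σ.injective (h.trans hp.symm)
    · exact σ.injective (h.trans hq.symm)
  by_cases hu : u₁ = u₂
  · subst hu
    have key : ∀ a b, ∏ u, A (consSlot a b K (σ (u, 0))) (consSlot a b K (σ (u, 1))) =
        A (consSlot a b K (σ (u₁, 0))) (consSlot a b K (σ (u₁, 1))) *
          ∏ u ∈ Finset.univ.erase u₁,
            A (consSlot 0 0 K (σ (u, 0))) (consSlot 0 0 K (σ (u, 1))) := by
      intro a b
      rw [← Finset.mul_prod_erase _ _ (Finset.mem_univ u₁)]
      congr 1
      refine Finset.prod_congr rfl fun u hu => ?_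
      have := (Finset.mem_erase.1 hu).1
      rw [hne (u, 0) (by simp [this]) (by simp [this]), hne (u, 1) (by simp [this]) (by simp [this])]
    simp only [key, ← sub_mul, ← Finset.sum_mul]
    have h2 : ∑ l ∈ Finset.range r, (A (2 * l) (2 * l + 1) - A (2 * l + 1) (2 * l)) = 0 := by
      simp only [hA.skew (2 * _ + 1) (2 * _), sub_neg_eq_add, Finset.sum_add_distrib, hA.trace,
        add_zero]
    have h3 : ∑ l ∈ Finset.range r, (A (2 * l + 1) (2 * l) - A (2 * l) (2 * l + 1)) = 0 := by
      rw [← neg_eq_zero, ← Finset.sum_neg_distrib]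
      simpa using h2
    have hxx : x₁ ≠ x₂ := by
      rintro rfl
      rw [hp] at hq
      simp at hq
    fin_cases x₁ <;> fin_cases x₂ <;> simp only [Fin.zero_eta, Fin.mk_one, ne_eq,
      not_true_eq_false] at hxx hp hq ⊢ <;> simp only [hp, hq, hx, hy, h2, h3, zero_mul]
  · have key : ∀ a b, ∏ u, A (consSlot a b K (σ (u, 0))) (consSlot a b K (σ (u, 1))) =
        (A (consSlot a b K (σ (u₁, 0))) (consSlot a b K (σ (u₁, 1))) *
         A (consSlot a b K (σ (u₂, 0))) (consSlot a b K (σ (u₂, 1)))) *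
          ∏ u ∈ (Finset.univ.erase u₁).erase u₂,
            A (consSlot 0 0 K (σ (u, 0))) (consSlot 0 0 K (σ (u, 1))) := by
      intro a b
      rw [← Finset.mul_prod_erase _ _ (Finset.mem_univ u₁), ← Finset.mul_prod_erase
        (Finset.univ.erase u₁) _ (Finset.mem_erase.2 ⟨Ne.symm hu, Finset.mem_univ u₂⟩), mul_assoc]
      congr 2
      refine Finset.prod_congr rfl fun u hu => ?_
      have h1 := (Finset.mem_erase.1 hu).1
      have h2 := (Finset.mem_erase.1 (Finset.mem_erase.1 hu).2).1
      rw [hne (u, 0) (by simp [h2]) (by simp [h1]),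
        hne (u, 1) (by simp [h2]) (by simp [h1])]
    simp only [key, ← sub_mul, ← Finset.sum_mul]
    have n1 : ∀ y z, ∑ l ∈ Finset.range r,
        (A (2 * l) y * A (2 * l + 1) z - A (2 * l + 1) y * A (2 * l) z) = 0 := by
      intro y z
      have := hA.null y z
      rw [← neg_eq_zero, ← Finset.sum_neg_distrib] at this
      rw [← this]
      refine Finset.sum_congr rfl fun l _ => ?_
      rw [hA.skew (2 * l) y, hA.skew (2 * l + 1) y]
      ring
    have hu' : ¬ u₂ = u₁ := fun h => hu h.symm
    have f1 : ∃ y ε, ∀ a b, A (consSlot a b K (σ (u₁, 0))) (consSlot a b K (σ (u₁, 1))) =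
        ε * A a y := by
      fin_cases x₁ <;> simp only [Fin.zero_eta, Fin.mk_one] at hp hne
      · refine ⟨consSlot 0 0 K (σ (u₁, 1)), 1, fun a b => ?_⟩
        rw [hp, hx, hne (u₁, 1) (by simp) (by simp [hu]), one_mul]
      · refine ⟨consSlot 0 0 K (σ (u₁, 0)), -1, fun a b => ?_⟩
        rw [hp, hx, hne (u₁, 0) (by simp) (by simp [hu]), hA.skew, neg_one_mul]
    have f2 : ∃ z ε, ∀ a b, A (consSlot a b K (σ (u₂, 0))) (consSlot a b K (σ (u₂, 1))) =
        ε * A b z := by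
      fin_cases x₂ <;> simp only [Fin.zero_eta, Fin.mk_one] at hq hne
      · refine ⟨consSlot 0 0 K (σ (u₂, 1)), 1, fun a b => ?_⟩
        rw [hq, hy, hne (u₂, 1) (by simp [hu']) (by simp), one_mul]
      · refine ⟨consSlot 0 0 K (σ (u₂, 0)), -1, fun a b => ?_⟩
        rw [hq, hy, hne (u₂, 0) (by simp [hu']) (by simp), hA.skew, neg_one_mul]
    obtain ⟨y, ε, f1⟩ := f1
    obtain ⟨z, ε', f2⟩ := f2
    have : ∑ l ∈ Finset.range r, (ε * A (2 * l) y * (ε' * A (2 * l + 1) z) -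
        ε * A (2 * l + 1) y * (ε' * A (2 * l) z)) = 0 := by
      rw [← mul_zero (ε * ε'), ← n1 y z, Finset.mul_sum]
      exact Finset.sum_congr rfl fun l _ => by ring
    simp only [f1, f2, this, zero_mul]

lemma sum_slotPf_consSlot {r : ℕ} {A : ℕ → ℕ → R} (hA : IsNullSkew r A)
    (h2 : IsUnit (2 : R)) (K : U × Fin 2 → ℕ) :
    ∑ l ∈ Finset.range r, slotPf A (consSlot (2 * l) (2 * l + 1) K) = 0 := by
  have hsw : ∀ l, slotPf A (consSlot (2 * l + 1) (2 * l) K) =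
      - slotPf A (consSlot (2 * l) (2 * l + 1) K) := by
    intro l
    have : consSlot (2 * l + 1) (2 * l) K =
        consSlot (2 * l) (2 * l + 1) K ∘ Equiv.swap (none, 0) (none, 1) := by
      funext p
      simp only [Function.comp_apply, consSlot_swap]
    rw [this, slotPf_comp_perm, Equiv.Perm.sign_swap (by simp)]
    simp
  have h : ∑ l ∈ Finset.range r, (slotPf A (consSlot (2 * l) (2 * l + 1) K) -
      slotPf A (consSlot (2 * l + 1) (2 * l) K)) = 0 := by
    simp only [slotPf, ← Finset.sum_sub_distrib, ← mul_sub]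
    rw [Finset.sum_comm]
    refine Finset.sum_eq_zero fun σ _ => ?_
    rw [← Finset.mul_sum, contraction_term hA, mul_zero]
  simp only [hsw, sub_neg_eq_add, ← two_mul, ← Finset.mul_sum] at h
  exact (h2.mul_right_eq_zero).1 h

end Contraction

/-- The partitions attached to the vertices of the growth diagram of a matrix `m` of
multiplicities (Burge / RSK local rules). -/
def grow (m : ℕ → ℕ → ℕ) : ℕ → ℕ → ℕ → ℕ
  | 0, _, _ => 0
  | _ + 1, 0, _ => 0
  | i + 1, j + 1, 0 => max (grow m i (j + 1) 0) (grow m (i + 1) j 0) + m i j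
  | i + 1, j + 1, t + 1 => max (grow m i (j + 1) (t + 1)) (grow m (i + 1) j (t + 1)) +
      min (grow m i (j + 1) t) (grow m (i + 1) j t) - grow m i j t

/-- The skew shape `μ / κ` is a horizontal strip. -/
def Interlaces (κ μ : ℕ → ℕ) : Prop := ∀ t, μ (t + 1) ≤ κ t ∧ κ t ≤ μ t

section Growth

variable (m : ℕ → ℕ → ℕ)

lemma grow_zero_left (j t : ℕ) : grow m 0 j t = 0 := by rw [grow]

lemma grow_zero_right (i t : ℕ) : grow m i 0 t = 0 := by cases i <;> rw [grow]

lemma grow_succ_zero (i j : ℕ) : grow m (i + 1) (j + 1) 0 =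
    max (grow m i (j + 1) 0) (grow m (i + 1) j 0) + m i j := by rw [grow]

lemma grow_succ_succ (i j t : ℕ) : grow m (i + 1) (j + 1) (t + 1) =
    max (grow m i (j + 1) (t + 1)) (grow m (i + 1) j (t + 1)) +
      min (grow m i (j + 1) t) (grow m (i + 1) j t) - grow m i j t := by rw [grow]

variable {m}

lemma grow_step {i j : ℕ} (h₁ : Interlaces (grow m i j) (grow m i (j + 1)))
    (h₂ : Interlaces (grow m i j) (grow m (i + 1) j)) :
    Interlaces (grow m (i + 1) j) (grow m (i + 1) (j + 1)) ∧
      Interlaces (grow m i (j + 1)) (grow m (i + 1) (j + 1)) := by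
  constructor <;> intro t
  · refine ⟨?_, ?_⟩
    · rw [grow_succ_succ]
      have := h₁ t; have := h₂ t; omega
    · cases t with
      | zero => rw [grow_succ_zero]; omega
      | succ t =>
        rw [grow_succ_succ]
        have := h₁ t; have := h₂ t; omega
  · refine ⟨?_, ?_⟩
    · rw [grow_succ_succ]
      have := h₁ t; have := h₂ t; omega
    · cases t with
      | zero => rw [grow_succ_zero]; omega
      | succ t =>
        rw [grow_succ_succ]
        have := h₁ t; have := h₂ t; omega

lemma grow_interlaces (i j : ℕ) : Interlaces (grow m i j) (grow m i (j + 1)) ∧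
    Interlaces (grow m i j) (grow m (i + 1) j) := by
  have vert : ∀ i, (∀ j, Interlaces (grow m i j) (grow m i (j + 1))) →
      ∀ j, Interlaces (grow m i j) (grow m (i + 1) j) := by
    intro i hi j
    induction j with
    | zero => intro t; simp [grow_zero_right]
    | succ j ih => exact (grow_step (hi j) ih).2
  have horiz : ∀ i j, Interlaces (grow m i j) (grow m i (j + 1)) := by
    intro i
    induction i with
    | zero => intro j t; simp [grow_zero_left]
    | succ i ih => exact fun j => (grow_step (ih j) (vert i ih j)).1
  exact ⟨horiz i j, vert i (horiz i) j⟩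

lemma grow_symm (hm : ∀ i j, m i j = m j i) (i j : ℕ) : grow m i j = grow m j i := by
  induction i generalizing j with
  | zero => funext t; rw [grow_zero_left, grow_zero_right]
  | succ i ihi =>
    induction j with
    | zero => funext t; rw [grow_zero_left, grow_zero_right]
    | succ j ihj =>
      funext t
      cases t with
      | zero =>
        rw [grow_succ_zero, grow_succ_zero, ihi, ihj, hm, max_comm]
      | succ t =>
        rw [grow_succ_succ, grow_succ_succ, ihi (j + 1), ihi j, ihj, max_comm, min_comm]

lemma grow_eq_zero (i j : ℕ) {t : ℕ} (ht : i ≤ t) : grow m i j t = 0 := by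
  induction i generalizing t with
  | zero => exact grow_zero_left m j t
  | succ i ih =>
    obtain ⟨t, rfl⟩ : ∃ s, t = s + 1 := ⟨t - 1, by omega⟩
    have := ((grow_interlaces (m := m) i j).2 t).1
    rw [ih (by omega)] at this
    omega

lemma sum_grow (i j N : ℕ) (hN : i ≤ N) :
    (∑ t ∈ Finset.range (N + 1), grow m (i + 1) (j + 1) t) + ∑ t ∈ Finset.range N, grow m i j t =
      (∑ t ∈ Finset.range (N + 1), grow m i (j + 1) t) +
        (∑ t ∈ Finset.range (N + 1), grow m (i + 1) j t) + m i j := by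
  have key : ∀ M, (∑ t ∈ Finset.range (M + 1), grow m (i + 1) (j + 1) t) +
      ∑ t ∈ Finset.range M, grow m i j t + min (grow m i (j + 1) M) (grow m (i + 1) j M) =
      (∑ t ∈ Finset.range (M + 1), grow m i (j + 1) t) +
        (∑ t ∈ Finset.range (M + 1), grow m (i + 1) j t) + m i j := by
    intro M
    induction M with
    | zero => simp [grow_succ_zero]; omega
    | succ M ih =>
      rw [Finset.sum_range_succ _ (M + 1), Finset.sum_range_succ (grow m i j) M,
        Finset.sum_range_succ (grow m i (j + 1)) (M + 1),
        Finset.sum_range_succ (grow m (i + 1) j) (M + 1), grow_succ_succ]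
      have h1 := (grow_interlaces (m := m) i j).1 M
      have h2 := (grow_interlaces (m := m) i j).2 M
      omega
  have := key N
  rw [grow_eq_zero i (j + 1) hN] at this
  omega

lemma sum_grow_row (i j N : ℕ) (hN : i < N) :
    ∑ t ∈ Finset.range N, grow m (i + 1) j t =
      (∑ t ∈ Finset.range N, grow m i j t) + ∑ b ∈ Finset.range j, m i b := by
  obtain ⟨N, rfl⟩ : ∃ s, N = s + 1 := ⟨N - 1, by omega⟩
  induction j with
  | zero => simp [grow_zero_right]
  | succ j ih =>
    have h := sum_grow (m := m) i j N (by omega)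
    rw [Finset.sum_range_succ (fun b => m i b)]
    rw [Finset.sum_range_succ (grow m i j), grow_eq_zero i j (by omega : i ≤ N)] at ih
    omega

lemma grow_diag (hm : ∀ i j, m i j = m j i) (hd : ∀ i, m i i = 0) (i u : ℕ) :
    grow m i i (2 * u) = grow m i i (2 * u + 1) := by
  induction i generalizing u with
  | zero => simp [grow_zero_left]
  | succ i ih =>
    have hs := grow_symm hm (i + 1) i
    have hl := (grow_interlaces (m := m) i i).1
    have h0 := ih u
    have h1 := hl (2 * u)
    have h2 := hl (2 * u + 1)
    rw [grow_succ_succ, hs]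
    cases u with
    | zero =>
      rw [Nat.mul_zero, grow_succ_zero, hs, hd]
      simp only [mul_zero] at *
      omega
    | succ u =>
      have h3 := hl (2 * u)
      have h4 := hl (2 * u + 1)
      have h5 := ih u
      rw [show 2 * (u + 1) = 2 * u + 1 + 1 by ring, grow_succ_succ, hs]
      rw [show 2 * (u + 1) = 2 * u + 1 + 1 by ring] at *
      omega

lemma grow_injective {m' : ℕ → ℕ → ℕ} (hm : ∀ i j, m i j = m j i) (hm' : ∀ i j, m' i j = m' j i)
    {n : ℕ} (h : ∀ i ≤ n, grow m i n = grow m' i n) {i j : ℕ} (hi : i < n) (hj : j < n) :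
    m i j = m' i j := by
  have back : ∀ i j, grow m (i + 1) (j + 1) = grow m' (i + 1) (j + 1) →
      grow m i (j + 1) = grow m' i (j + 1) → grow m (i + 1) j = grow m' (i + 1) j →
      grow m i j = grow m' i j ∧ m i j = m' i j := by
    intro i j e1 e2 e3
    constructor
    · funext t
      have a := congrFun e1 (t + 1)
      rw [grow_succ_succ, grow_succ_succ, e2, e3] at a
      have h1 := (grow_interlaces (m := m) i j).1 t
      have h2 := (grow_interlaces (m := m) i j).2 t
      have h3 := (grow_interlaces (m := m') i j).1 t
      have h4 := (grow_interlaces (m := m') i j).2 t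
      rw [e2] at h1; rw [e3] at h2
      omega
    · have a := congrFun e1 0
      rw [grow_succ_zero, grow_succ_zero, e2, e3] at a
      omega
  have all : ∀ a ≤ n, ∀ b ≤ n, grow m (n - a) (n - b) = grow m' (n - a) (n - b) := by
    intro a
    induction a with
    | zero =>
      intro _ b _
      rw [Nat.sub_zero, grow_symm hm, grow_symm hm', h _ (by omega)]
    | succ a iha =>
      intro ha b
      induction b with
      | zero => intro _; exact h _ (by omega)
      | succ b ihb =>
        intro hb
        refine (back _ _ ?_ ?_ ?_).1
        · rw [show n - (a + 1) + 1 = n - a by omega, show n - (b + 1) + 1 = n - b by omega]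
          exact iha (by omega) b (by omega)
        · rw [show n - (b + 1) + 1 = n - b by omega]
          exact ihb (by omega)
        · rw [show n - (a + 1) + 1 = n - a by omega]
          exact iha (by omega) _ hb
  have all' : ∀ a ≤ n, ∀ b ≤ n, grow m a b = grow m' a b := by
    intro a ha b hb
    have := all (n - a) (by omega) (n - b) (by omega)
    rwa [show n - (n - a) = a by omega, show n - (n - b) = b by omega] at this
  exact (back i j (all' _ hi _ hj) (all' _ hi.le _ hj) (all' _ hi _ hj.le)).2

end Growth

section SympForm

variable {R U : Type*} [CommRing R] [Fintype U] [DecidableEq U]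

lemma slotPf_sub_transpose (B : ℕ → ℕ → R) (K : U × Fin 2 → ℕ) :
    slotPf (fun i j => B i j - B j i) K = 2 ^ Fintype.card U * slotPf B K := by
  let D : U → Bool → (Equiv.Perm (U × Fin 2)) → R := fun u b σ =>
    if b then B (K (σ (u, 0))) (K (σ (u, 1))) - B (K (σ (u, 1))) (K (σ (u, 0)))
    else B (K (σ (u, 0))) (K (σ (u, 1)))
  have main : ∀ T : Finset U, ∑ σ : Equiv.Perm (U × Fin 2), ((Equiv.Perm.sign σ : ℤ) : R) *
      ∏ u, D u (decide (u ∈ T)) σ = 2 ^ T.card * slotPf B K := by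
    intro T
    induction T using Finset.induction_on with
    | empty => simp [slotPf, D]
    | insert a T ha ih =>
      have hprod : ∀ σ : Equiv.Perm (U × Fin 2), ∏ u, D u (decide (u ∈ insert a T)) σ =
          D a true σ * ∏ u ∈ Finset.univ.erase a, D u (decide (u ∈ T)) σ := by
        intro σ
        rw [← Finset.mul_prod_erase _ _ (Finset.mem_univ a)]
        congr 1
        · simp
        · refine Finset.prod_congr rfl fun u hu => ?_
          simp [(Finset.mem_erase.1 hu).1]
      have hprod' : ∀ σ : Equiv.Perm (U × Fin 2), ∏ u, D u (decide (u ∈ T)) σ =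
          D a false σ * ∏ u ∈ Finset.univ.erase a, D u (decide (u ∈ T)) σ := by
        intro σ
        rw [← Finset.mul_prod_erase _ _ (Finset.mem_univ a)]
        simp [ha]
      let τ : Equiv.Perm (U × Fin 2) := Equiv.swap (a, 0) (a, 1)
      have hτ : ∀ u ≠ a, ∀ x, τ (u, x) = (u, x) := fun u hu x =>
        Equiv.swap_apply_of_ne_of_ne (by simp [hu]) (by simp [hu])
      have hsw : ∑ σ : Equiv.Perm (U × Fin 2), ((Equiv.Perm.sign σ : ℤ) : R) *
          (B (K (σ (a, 1))) (K (σ (a, 0))) *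
            ∏ u ∈ Finset.univ.erase a, D u (decide (u ∈ T)) σ) =
          - ∑ σ : Equiv.Perm (U × Fin 2), ((Equiv.Perm.sign σ : ℤ) : R) *
            ∏ u, D u (decide (u ∈ T)) σ := by
        rw [← Equiv.sum_comp (Equiv.mulRight τ), ← Finset.sum_neg_distrib]
        refine Finset.sum_congr rfl fun σ _ => ?_
        have hp : ∏ u ∈ Finset.univ.erase a, D u (decide (u ∈ T)) (σ * τ) =
            ∏ u ∈ Finset.univ.erase a, D u (decide (u ∈ T)) σ := by
          refine Finset.prod_congr rfl fun u hu => ?_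
          have hu := (Finset.mem_erase.1 hu).1
          simp only [D, Equiv.Perm.mul_apply, hτ u hu]
        rw [Equiv.coe_mulRight, hp, hprod']
        simp [D, τ, Equiv.Perm.sign_mul]
      have : ∀ σ, D a true σ = D a false σ - B (K (σ (a, 1))) (K (σ (a, 0))) := by
        intro σ; simp [D]
      simp only [hprod, this, sub_mul, mul_sub, Finset.sum_sub_distrib, ← hprod', hsw]
      rw [sub_neg_eq_add, ih, Finset.card_insert_of_notMem ha]
      ring
  have := main Finset.univ
  simpa [D, slotPf] using this

/-- The Gram matrix `Pᵀ ω P` of the columns of `P`, where `ω` is the alternating form on `2 r`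
rows pairing the rows `2 q` and `2 q + 1`. -/
def sympForm (r : ℕ) (P : ℕ → ℕ → R) (i j : ℕ) : R :=
  ∑ q : Fin r, (P (2 * q) i * P (2 * q + 1) j - P (2 * q + 1) i * P (2 * q) j)

lemma slotPf_sympForm (r : ℕ) (P : ℕ → ℕ → R) (K : U × Fin 2 → ℕ) :
    slotPf (sympForm r P) K = 2 ^ Fintype.card U *
      ∑ f : U → Fin r, (Matrix.of fun a b : U × Fin 2 => P (2 * f b.1 + b.2) (K a)).det := by
  have h : sympForm r P = fun i j => (∑ q : Fin r, P (2 * q) i * P (2 * q + 1) j) -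
      ∑ q : Fin r, P (2 * q) j * P (2 * q + 1) i := by
    funext i j
    simp only [sympForm, Finset.sum_sub_distrib]
    congr 1
    exact Finset.sum_congr rfl fun q _ => mul_comm _ _
  rw [h, slotPf_sub_transpose (fun i j => ∑ q : Fin r, P (2 * q) i * P (2 * q + 1) j)]
  congr 1
  simp only [slotPf, Matrix.det_apply', Finset.prod_univ_sum, Finset.mul_sum, Fintype.piFinset_univ]
  rw [Finset.sum_comm]
  refine Finset.sum_congr rfl fun f _ => Finset.sum_congr rfl fun σ _ => ?_
  congr 1
  rw [Fintype.prod_prod_type]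
  simp

lemma slotPf_sympForm_injective (r : ℕ) (P : ℕ → ℕ → R) (K : U × Fin 2 → ℕ) :
    slotPf (sympForm r P) K = 2 ^ Fintype.card U *
      ∑ f : U ↪ Fin r, ∑ σ : Equiv.Perm (U × Fin 2), ((Equiv.Perm.sign σ : ℤ) : R) *
        ∏ p, P (2 * f (σ p).1 + (σ p).2) (K p) := by
  rw [slotPf_sympForm]
  congr 1
  have h0 : ∀ f : U → Fin r, ¬ Function.Injective f →
      (Matrix.of fun a b : U × Fin 2 => P (2 * f b.1 + b.2) (K a)).det = 0 := by
    intro f hf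
    obtain ⟨u, v, h, hne⟩ : ∃ u v, f u = f v ∧ u ≠ v := by
      simpa only [Function.Injective, not_forall, exists_prop] using hf
    exact Matrix.det_zero_of_column_eq (i := (u, 0)) (j := (v, 0)) (by simp [hne]) (by simp [h])
  have h1 : ∀ f : U → Fin r, (Matrix.of fun a b : U × Fin 2 => P (2 * f b.1 + b.2) (K a)).det =
      ∑ σ : Equiv.Perm (U × Fin 2), ((Equiv.Perm.sign σ : ℤ) : R) *
        ∏ p, P (2 * f (σ p).1 + (σ p).2) (K p) := by
    intro f
    rw [← Matrix.det_transpose, Matrix.det_apply']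
    simp
  simp only [← h1]
  symm
  refine Finset.sum_of_injOn (fun f : U ↪ Fin r => (f : U → Fin r)) ?_ ?_ ?_ ?_
  · exact fun a _ b _ h => DFunLike.coe_injective h
  · simp
  · intro f _ hf
    refine h0 f fun hinj => hf ?_
    simp only [Finset.coe_univ, Set.image_univ, Set.mem_range]
    exact ⟨⟨f, hinj⟩, rfl⟩
  · intros; rfl

end SympForm

section Leading

open MvPolynomial

/-- The exponent of the monomial with one variable in row `ρ p` and column `K p` for each `p`. -/
def rowExp {I : Type*} [Fintype I] {N : ℕ} (ρ K : I → Fin N) : (Fin N ×ₗ Fin N) →₀ ℕ :=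
  ∑ p, Finsupp.single (toLex (ρ p, K p)) 1

lemma rowExp_apply {I : Type*} [Fintype I] {N : ℕ} (ρ K : I → Fin N) (i : Fin N ×ₗ Fin N) :
    rowExp ρ K i = (Finset.univ.filter fun p => toLex (ρ p, K p) = i).card := by
  simp [rowExp, Finsupp.finsetSum_apply, Finsupp.single_apply]

lemma rowExp_lt {I : Type*} [Fintype I] {N : ℕ} {ρ₀ ρ K : I → Fin N}
    (hρ : Function.Injective ρ) (h₀ : Function.Injective ρ₀)
    (hK : ∀ p q, ρ₀ p < ρ₀ q ↔ K p < K q)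
    (hseg : ∀ p, ∀ t < ρ₀ p, ∃ q, ρ₀ q = t) (hne : ρ ≠ ρ₀) :
    toLex (rowExp ρ K) < toLex (rowExp ρ₀ K) := by
  have hKi : Function.Injective K := by
    intro p q h
    apply h₀
    apply le_antisymm <;> rw [← not_lt, hK, h] <;> exact lt_irrefl _
  obtain ⟨p₁, hp₁⟩ : ∃ p, ρ p ≠ ρ₀ p := by
    by_contra! h
    exact hne (funext h)
  obtain ⟨p₀, hp₀, hmin⟩ := Set.exists_min_image {p | ρ p ≠ ρ₀ p} ρ₀ (Set.toFinite _) ⟨p₁, hp₁⟩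
  have hmin' : ∀ p, ρ₀ p < ρ₀ p₀ → ρ p = ρ₀ p := by
    intro p hp
    by_contra h
    exact absurd (hmin p h) (not_le.2 hp)
  rw [Finsupp.Lex.lt_iff]
  refine ⟨toLex (ρ₀ p₀, K p₀), ?_, ?_⟩
  · intro j hj
    obtain ⟨⟨t, k⟩, rfl⟩ := toLex.surjective j
    change rowExp ρ K _ = rowExp ρ₀ K _
    rw [rowExp_apply, rowExp_apply]
    congr 1
    refine Finset.filter_congr fun p _ => ?_
    simp only [EmbeddingLike.apply_eq_iff_eq, Prod.mk.injEq]
    rw [Prod.Lex.toLex_lt_toLex] at hj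
    refine and_congr_left fun hk => ?_
    rcases hj with ht | ⟨ht, hj⟩
    · constructor
      · intro h
        obtain ⟨q, hq⟩ := hseg p₀ t ht
        have : ρ q = t := by rw [hmin' q (by rw [hq]; exact ht), hq]
        rw [hρ (h.trans this.symm), hq]
      · intro h
        rw [hmin' p (by rw [h]; exact ht), h]
    · simp only at ht hj
      subst hk
      rw [← hK] at hj
      rw [hmin' p hj]
  · change rowExp ρ K _ < rowExp ρ₀ K _
    rw [rowExp_apply, rowExp_apply]
    have h1 : (Finset.univ.filter fun p => toLex (ρ p, K p) = toLex (ρ₀ p₀, K p₀)) = ∅ := by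
      refine Finset.filter_eq_empty_iff.2 fun p _ h => ?_
      simp only [EmbeddingLike.apply_eq_iff_eq, Prod.mk.injEq] at h
      have := hKi h.2
      subst this
      exact hp₀ h.1
    rw [h1, Finset.card_empty]
    exact Finset.card_pos.2 ⟨p₀, by simp⟩

open Classical in
/-- The generic matrix with entries supported on the positions satisfying `al`. -/
def genP (N : ℕ) (F : Type*) [Field F] (al : ℕ → ℕ → Prop) (t j : ℕ) :
    MvPolynomial (Fin N ×ₗ Fin N) F :=
  if h : t < N ∧ j < N ∧ al t j then X (toLex (⟨t, h.1⟩, ⟨j, h.2.1⟩)) else 0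

variable {r : ℕ} {F : Type*} [Field F] {al : ℕ → ℕ → Prop}

lemma prod_genP {I : Type*} [Fintype I] (ρ K : I → Fin (2 * r))
    (h : ∀ p, al (ρ p) (K p)) :
    ∏ p, genP (2 * r) F al (ρ p) (K p) = monomial (rowExp ρ K) 1 := by
  rw [rowExp, monomial_sum_one]
  refine Finset.prod_congr rfl fun p _ => ?_
  rw [genP, dif_pos ⟨(ρ p).2, (K p).2, h p⟩]
  rfl

lemma prod_genP_eq_zero {I : Type*} [Fintype I] (ρ K : I → Fin (2 * r))
    (h : ¬ ∀ p, al (ρ p) (K p)) :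
    ∏ p, genP (2 * r) F al (ρ p) (K p) = 0 := by
  push Not at h
  obtain ⟨p, hp⟩ := h
  refine Finset.prod_eq_zero (Finset.mem_univ p) ?_
  rw [genP, dif_neg]
  simp [hp]

/-- The row in which the slot `p` is filled in the leading term. -/
def slotRow {s : ℕ} (hs : s ≤ r) (p : Fin s × Fin 2) : Fin (2 * r) :=
  ⟨2 * p.1 + p.2, by have := p.1.2; have := p.2.2; omega⟩

lemma slotRow_injective {s : ℕ} (hs : s ≤ r) : Function.Injective (slotRow hs) := by
  rintro ⟨u, x⟩ ⟨v, y⟩ h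
  simp only [slotRow, Fin.mk.injEq] at h
  ext <;> simp only <;> omega

variable {s : ℕ}

/-- The row of the slot `p` in the term indexed by `f` and `σ`. -/
def termRow (f : Fin s ↪ Fin r) (σ : Equiv.Perm (Fin s × Fin 2)) (p : Fin s × Fin 2) :
    Fin (2 * r) :=
  ⟨2 * f (σ p).1 + (σ p).2, by have := (f (σ p).1).2; have := (σ p).2.2; omega⟩

lemma termRow_injective (f : Fin s ↪ Fin r) (σ : Equiv.Perm (Fin s × Fin 2)) :
    Function.Injective (termRow f σ) := by
  intro p q h
  simp only [termRow, Fin.mk.injEq] at h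
  apply σ.injective
  ext
  · have : f (σ p).1 = f (σ q).1 := by ext; omega
    rw [f.injective this]
  · omega

lemma sum_sign_termRow (hs : s ≤ r) :
    ∑ f : Fin s ↪ Fin r, ∑ σ : Equiv.Perm (Fin s × Fin 2),
      ((Equiv.Perm.sign σ : ℤ) : F) * (if termRow f σ = slotRow hs then 1 else 0) =
      (s.factorial : F) := by
  have hc : (s.factorial : F) = ∑ _π : Equiv.Perm (Fin s), (1 : F) := by
    simp [Fintype.card_perm]
  rw [← Finset.sum_product', hc]
  symm
  refine Finset.sum_of_injOn (fun π : Equiv.Perm (Fin s) =>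
    ((π.toEmbedding.trans (Fin.castLEEmb hs)), Equiv.prodCongrLeft fun _ => π⁻¹)) ?_ ?_ ?_ ?_
  · intro π _ π' _ h
    simp only [Prod.mk.injEq] at h
    ext x
    have := DFunLike.congr_fun h.1 x
    simpa [Fin.ext_iff] using this
  · simp
  · rintro ⟨f, σ⟩ _ h
    rw [if_neg, mul_zero]
    intro heq
    apply h
    have hval : ∀ p, 2 * (f (σ p).1 : ℕ) + (σ p).2 = 2 * p.1 + p.2 := by
      intro p
      have := congrFun heq p
      simpa [termRow, slotRow] using this
    have h2 : ∀ p, (σ p).2 = p.2 := fun p => by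
      have := hval p; ext; omega
    have h1 : ∀ p, (f (σ p).1 : ℕ) = p.1 := fun p => by
      have := hval p; have := congrArg Fin.val (h2 p); omega
    have hf : ∀ u, (f u : ℕ) < s := by
      intro u
      have := h1 (σ.symm (u, 0))
      simp only [Equiv.apply_symm_apply] at this
      rw [this]; exact (σ.symm (u, 0)).1.2
    let g : Fin s → Fin s := fun u => ⟨f u, hf u⟩
    have hg : Function.Injective g := by
      intro u v huv
      apply f.injective
      simp only [g, Fin.mk.injEq] at huv
      exact Fin.ext huv
    let π : Equiv.Perm (Fin s) := Equiv.ofBijective g (Finite.injective_iff_bijective.1 hg)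
    refine ⟨π, by simp, ?_⟩
    ext p
    · simp [π, g]
    · have : (σ p).1 = π⁻¹ p.1 := by
        rw [Equiv.Perm.eq_inv_iff_eq]
        ext
        simp [π, g, h1]
      rw [this]; rfl
    · rw [h2 p]; rfl
  · intro π _
    have hrow : termRow (π.toEmbedding.trans (Fin.castLEEmb hs))
        (Equiv.prodCongrLeft fun _ => π⁻¹) = slotRow hs := by
      funext p
      obtain ⟨u, x⟩ := p
      simp [termRow, slotRow]
    rw [if_pos hrow, Equiv.Perm.sign_prodCongrLeft]
    rcases Int.units_eq_one_or (Equiv.Perm.sign π⁻¹) with h | h <;> simp [h]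

/-- A slot pfaffian of the Gram matrix of a generic matrix is nonzero, and its leading monomial is
the diagonal one. -/
lemma leading_slotPf (hs : s ≤ r) (hF : ∀ k, 0 < k → k ≤ r → (k : F) ≠ 0) (h2 : (2 : F) ≠ 0)
    (K : Fin s × Fin 2 → Fin (2 * r))
    (hK : ∀ p q, slotRow hs p < slotRow hs q ↔ K p < K q)
    (hal : ∀ p, al (slotRow hs p) (K p)) :
    slotPf (sympForm r (genP (2 * r) F al)) (fun p => (K p : ℕ)) ≠ 0 ∧
    MonomialOrder.lex.degree (slotPf (sympForm r (genP (2 * r) F al)) (fun p => (K p : ℕ))) =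
      rowExp (slotRow hs) K := by
  set Q := slotPf (sympForm r (genP (2 * r) F al)) (fun p => (K p : ℕ)) with hQ
  have hQ' : Q = C (2 ^ s) * ∑ f : Fin s ↪ Fin r, ∑ σ : Equiv.Perm (Fin s × Fin 2),
      C ((Equiv.Perm.sign σ : ℤ) : F) *
        ∏ p, genP (2 * r) F al (termRow f σ p) (K p) := by
    rw [hQ, slotPf_sympForm_injective]
    rw [map_pow, map_ofNat]
    simp [termRow]
  have hseg : ∀ p : Fin s × Fin 2, ∀ t < slotRow hs p, ∃ q, slotRow hs q = t := by
    intro p t ht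
    have ht : (t : ℕ) < 2 * p.1 + p.2 := ht
    have h1 := p.1.2
    have h2 := p.2.2
    refine ⟨(⟨t / 2, by omega⟩, ⟨t % 2, by omega⟩), ?_⟩
    ext
    simp only [slotRow]
    omega
  have hlt : ∀ f σ, termRow f σ ≠ slotRow hs →
      toLex (rowExp (termRow f σ) K) < toLex (rowExp (slotRow hs) K) := fun f σ hne =>
    rowExp_lt (termRow_injective f σ) (slotRow_injective hs) hK hseg hne
  have hcoeff : ∀ f σ d, toLex (rowExp (slotRow hs) K) ≤ toLex d →
      coeff d (∏ p, genP (2 * r) F al (termRow f σ p) (K p)) =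
      if termRow f σ = slotRow hs ∧ d = rowExp (slotRow hs) K then 1 else 0 := by
    intro f σ d hd
    by_cases heq : termRow f σ = slotRow hs
    · rw [prod_genP _ _ (by rw [heq]; exact hal), coeff_monomial, heq]
      simp [eq_comm]
    · rw [if_neg (fun h => heq h.1)]
      by_cases hall : ∀ p, al (termRow f σ p) (K p)
      · rw [prod_genP _ _ hall, coeff_monomial, if_neg]
        intro h
        rw [← h] at hd
        exact absurd (hlt f σ heq) (not_lt.2 hd)
      · rw [prod_genP_eq_zero _ _ hall, coeff_zero]
  have hc : ∀ d, toLex (rowExp (slotRow hs) K) ≤ toLex d → coeff d Q =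
      if d = rowExp (slotRow hs) K then 2 ^ s * (s.factorial : F) else 0 := by
    intro d hd
    rw [hQ', coeff_C_mul, coeff_sum]
    simp only [coeff_sum, coeff_C_mul, hcoeff _ _ d hd]
    by_cases h : d = rowExp (slotRow hs) K
    · simp only [h, and_true, if_true]
      rw [sum_sign_termRow hs]
    · simp [h]
  have hne : coeff (rowExp (slotRow hs) K) Q ≠ 0 := by
    rw [hc _ le_rfl, if_pos rfl]
    refine mul_ne_zero (pow_ne_zero _ h2) ?_
    rw [← Finset.prod_range_add_one_eq_factorial, Nat.cast_prod, Finset.prod_ne_zero_iff]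
    intro k hk
    rw [Finset.mem_range] at hk
    exact hF _ (by omega) (by omega)
  refine ⟨fun h => hne (by rw [h, coeff_zero]), ?_⟩
  apply MonomialOrder.lex.toSyn.injective
  apply le_antisymm
  · rw [MonomialOrder.degree_le_iff]
    intro d hd
    rw [MonomialOrder.lex_le_iff]
    by_contra h
    rw [not_le] at h
    rw [mem_support_iff, hc d h.le, if_neg] at hd
    · exact hd rfl
    · rintro rfl
      exact lt_irrefl _ h
  · exact MonomialOrder.le_degree (mem_support_iff.2 hne)

end Leading

section Chains

open MvPolynomial

/-- An interlacing chain of partitions whose `2r`-th member has columns of even length. -/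
structure IsEvenChain (r : ℕ) (c : ℕ → ℕ → ℕ) : Prop where
  zero : ∀ t, c 0 t = 0
  interlaces : ∀ j, Interlaces (c j) (c (j + 1))
  even : ∀ u, c (2 * r) (2 * u) = c (2 * r) (2 * u + 1)

/-- The letter at height `t` of the `q`-th column of the tableau encoded by the chain `c`. -/
def colLetter (c : ℕ → ℕ → ℕ) (q t : ℕ) : ℕ := sInf {j | q < c (j + 1) t}

/-- Half the length of the `q`-th column of the tableau encoded by the chain `c`. -/
def colSize (r : ℕ) (c : ℕ → ℕ → ℕ) (q : ℕ) : ℕ := sInf {u | c (2 * r) (2 * u) ≤ q}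

namespace IsEvenChain

variable {r : ℕ} {c : ℕ → ℕ → ℕ} (hc : IsEvenChain r c)
include hc

lemma eq_zero {j t : ℕ} (h : j ≤ t) : c j t = 0 := by
  induction j generalizing t with
  | zero => exact hc.zero t
  | succ j ih =>
    obtain ⟨t, rfl⟩ : ∃ t', t = t' + 1 := ⟨t - 1, by omega⟩
    have := (hc.interlaces j t).1
    have := @ih t (by omega)
    omega

lemma mono (t : ℕ) : Monotone fun j => c j t :=
  monotone_nat_of_le_succ fun j => (hc.interlaces j t).2

lemma anti (j : ℕ) : Antitone (c j) := by
  refine antitone_nat_of_succ_le fun t => ?_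
  cases j with
  | zero => rw [hc.zero, hc.zero]
  | succ j => exact (hc.interlaces j t).1.trans (hc.interlaces j t).2

lemma colLetter_spec {q t : ℕ} (h : q < c (2 * r) t) :
    c (colLetter c q t) t ≤ q ∧ q < c (colLetter c q t + 1) t ∧ colLetter c q t < 2 * r := by
  have hpos : 2 * r ≠ 0 := by
    intro h0
    rw [h0, hc.zero] at h
    omega
  have hmem : 2 * r - 1 ∈ {j | q < c (j + 1) t} := by
    simp only [Set.mem_ofPred_eq]
    rwa [Nat.sub_add_cancel (by omega)]
  have h1 : colLetter c q t ∈ {j | q < c (j + 1) t} := Nat.sInf_mem ⟨_, hmem⟩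
  have h2 : colLetter c q t ≤ 2 * r - 1 := Nat.sInf_le hmem
  refine ⟨?_, h1, by omega⟩
  by_contra! h3
  rcases Nat.eq_zero_or_pos (colLetter c q t) with h0 | h0
  · rw [h0, hc.zero] at h3
    omega
  · have : colLetter c q t ≤ colLetter c q t - 1 := Nat.sInf_le (by
      simp only [Set.mem_ofPred_eq]
      rwa [Nat.sub_add_cancel (by omega)])
    omega

lemma colLetter_eq_iff {q t j : ℕ} (h : q < c (2 * r) t) :
    colLetter c q t = j ↔ c j t ≤ q ∧ q < c (j + 1) t := by
  obtain ⟨h1, h2, -⟩ := hc.colLetter_spec h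
  constructor
  · rintro rfl
    exact ⟨h1, h2⟩
  · rintro ⟨h3, h4⟩
    have m1 := fun h => hc.mono t (a := colLetter c q t + 1) (b := j) h
    have m2 := fun h => hc.mono t (a := j + 1) (b := colLetter c q t) h
    simp only at m1 m2
    by_contra hne
    rcases lt_or_gt_of_ne hne with h | h
    · have := m1 h
      omega
    · have := m2 h
      omega

lemma colLetter_lt_succ {q t : ℕ} (h : q < c (2 * r) (t + 1)) :
    colLetter c q t < colLetter c q (t + 1) := by
  obtain ⟨h1, h2, -⟩ := hc.colLetter_spec h
  have h3 := (hc.interlaces (colLetter c q (t + 1)) t).1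
  obtain ⟨k, hk⟩ : ∃ k, colLetter c q (t + 1) = k + 1 := by
    refine Nat.exists_eq_succ_of_ne_zero fun h0 => ?_
    rw [h0, hc.zero] at h3
    rw [h0] at h2
    omega
  rw [hk]
  refine Nat.lt_succ_of_le (Nat.sInf_le ?_)
  simp only [Set.mem_ofPred_eq]
  rw [← hk]
  omega

lemma colLetter_lt {q t t' : ℕ} (htt : t < t') (h : q < c (2 * r) t') :
    colLetter c q t < colLetter c q t' := by
  induction t', htt using Nat.le_induction with
  | base => exact hc.colLetter_lt_succ h
  | succ k hk ih =>
    exact (ih (h.trans_le (hc.anti _ (Nat.le_succ k)))).trans (hc.colLetter_lt_succ h)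

lemma lt_colSize_iff {q t : ℕ} : t < 2 * colSize r c q ↔ q < c (2 * r) t := by
  have hmem : r ∈ {u | c (2 * r) (2 * u) ≤ q} := by
    simp only [Set.mem_ofPred_eq]
    rw [hc.eq_zero le_rfl]
    exact Nat.zero_le _
  have h1 : c (2 * r) (2 * colSize r c q) ≤ q := Nat.sInf_mem (s := {u | c (2 * r) (2 * u) ≤ q}) ⟨_, hmem⟩
  have key : c (2 * r) t = c (2 * r) (2 * (t / 2)) := by
    rcases Nat.mod_two_eq_zero_or_one t with h | h
    · congr 1; omega
    · rw [hc.even]; congr 1; omega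
  rw [key]
  constructor
  · intro h
    by_contra! h'
    have : colSize r c q ≤ t / 2 := Nat.sInf_le (s := {u | c (2 * r) (2 * u) ≤ q}) h'
    omega
  · intro h
    by_contra! h'
    have := hc.anti (2 * r) (a := 2 * colSize r c q) (b := 2 * (t / 2)) (by omega)
    omega

lemma colSize_le (q : ℕ) : colSize r c q ≤ r := by
  by_contra! h
  have := (hc.lt_colSize_iff (q := q) (t := 2 * r)).1 (by omega)
  rw [hc.eq_zero le_rfl] at this
  omega

end IsEvenChain

/-- The entries of the `q`-th column of the tableau encoded by the chain `c`. -/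
def column (r : ℕ) (c : ℕ → ℕ → ℕ) (q : ℕ) (p : Fin (colSize r c q) × Fin 2) : ℕ :=
  colLetter c q (2 * p.1 + p.2)

/-- The product of the pfaffians of the columns of the tableau encoded by the chain `c`. -/
def chainProd {R : Type*} [CommRing R] (r : ℕ) (c : ℕ → ℕ → ℕ) (A : ℕ → ℕ → R) : R :=
  ∏ q ∈ Finset.range (c (2 * r) 0), slotPf A (column r c q)

lemma chainProd_map {R S : Type*} [CommRing R] [CommRing S] (r : ℕ) (c : ℕ → ℕ → ℕ)
    (A : ℕ → ℕ → R) (f : R →+* S) :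
    f (chainProd r c A) = chainProd r c fun i j => f (A i j) := by
  rw [chainProd, chainProd, map_prod]
  exact Finset.prod_congr rfl fun q _ => slotPf_map ..

variable {r : ℕ} {c : ℕ → ℕ → ℕ}

lemma IsEvenChain.lt_of_slot (hc : IsEvenChain r c) {q : ℕ} (p : Fin (colSize r c q) × Fin 2) :
    q < c (2 * r) (2 * p.1 + p.2) := by
  rw [← hc.lt_colSize_iff]
  have := p.1.2
  have := p.2.2
  omega

lemma IsEvenChain.column_lt (hc : IsEvenChain r c) {q : ℕ} (p : Fin (colSize r c q) × Fin 2) :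
    column r c q p < 2 * r :=
  (hc.colLetter_spec (hc.lt_of_slot p)).2.2

lemma IsEvenChain.count (hc : IsEvenChain r c) {j t : ℕ} (hj : j < 2 * r) :
    ((Finset.range (c (2 * r) 0)).filter
      fun q => q < c (2 * r) t ∧ colLetter c q t = j).card = c (j + 1) t - c j t := by
  rw [← Nat.card_Ico]
  congr 1
  ext q
  simp only [Finset.mem_filter, Finset.mem_range, Finset.mem_Ico]
  have h1 := hc.anti (2 * r) (Nat.zero_le t)
  have h2 := hc.mono t (a := j + 1) (b := 2 * r) hj
  simp only at h2
  constructor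
  · rintro ⟨-, h, h'⟩
    exact (hc.colLetter_eq_iff h).1 h'
  · intro h
    have h3 : q < c (2 * r) t := by omega
    exact ⟨by omega, h3, (hc.colLetter_eq_iff h3).2 h⟩

variable {F : Type*} [Field F] {al : ℕ → ℕ → Prop}

lemma IsEvenChain.leading (hc : IsEvenChain r c)
    (hF : ∀ k, 0 < k → k ≤ r → (k : F) ≠ 0) (h2 : (2 : F) ≠ 0)
    (hal : ∀ q t, q < c (2 * r) t → al t (colLetter c q t)) :
    chainProd r c (sympForm r (genP (2 * r) F al)) ≠ 0 ∧
    ∀ t j : Fin (2 * r),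
      MonomialOrder.lex.degree (chainProd r c (sympForm r (genP (2 * r) F al))) (toLex (t, j)) =
        c (j + 1) t - c j t := by
  have key := fun q => leading_slotPf (hc.colSize_le q) hF h2 (al := al)
    (fun p => ⟨column r c q p, hc.column_lt p⟩) (by
      intro p p'
      have hp := hc.lt_of_slot p
      have hp' := hc.lt_of_slot p'
      rw [Fin.mk_lt_mk]
      change 2 * (p.1 : ℕ) + p.2 < 2 * p'.1 + p'.2 ↔ _
      refine ⟨fun h => hc.colLetter_lt h hp', fun h => ?_⟩
      by_contra! h'
      rcases h'.eq_or_lt with h'' | h''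
      · have h : column r c q p < column r c q p' := h
        rw [column, column, h''] at h
        exact lt_irrefl _ h
      · exact absurd (hc.colLetter_lt h'' hp) (not_lt.2 (le_of_lt h))) (fun p => hal _ _ (hc.lt_of_slot p))
  have hne : ∀ q ∈ Finset.range (c (2 * r) 0),
      slotPf (sympForm r (genP (2 * r) F al)) (column r c q) ≠ 0 := fun q _ => (key q).1
  refine ⟨Finset.prod_ne_zero_iff.2 hne, fun t j => ?_⟩
  rw [chainProd, MonomialOrder.degree_prod hne, Finsupp.finsetSum_apply, ← hc.count j.2,
    Finset.card_filter]
  refine Finset.sum_congr rfl fun q _ => ?_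
  have hk : MonomialOrder.lex.degree (slotPf (sympForm r (genP (2 * r) F al)) (column r c q)) = _ :=
    (key q).2
  rw [hk, rowExp_apply]
  by_cases h : q < c (2 * r) t ∧ colLetter c q t = j
  · rw [if_pos h, Finset.card_eq_one]
    have ht := hc.lt_colSize_iff.2 h.1
    refine ⟨(⟨t / 2, by omega⟩, ⟨t % 2, by omega⟩), ?_⟩
    ext p
    simp only [Finset.mem_filter, Finset.mem_univ, true_and, EmbeddingLike.apply_eq_iff_eq,
      Prod.mk.injEq, Finset.mem_singleton]
    constructor
    · rintro ⟨hp, -⟩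
      have hp : 2 * (p.1 : ℕ) + p.2 = t := congrArg Fin.val hp
      ext <;> simp only <;> omega
    · rintro rfl
      have e : 2 * ((t : ℕ) / 2) + t % 2 = t := by omega
      refine ⟨Fin.ext e, Fin.ext ?_⟩
      simp only [column]
      rw [e, h.2]
  · rw [if_neg h, Finset.card_eq_zero, Finset.filter_eq_empty_iff]
    intro p _ hp
    simp only [EmbeddingLike.apply_eq_iff_eq, Prod.mk.injEq] at hp
    have hp1 : 2 * (p.1 : ℕ) + p.2 = t := congrArg Fin.val hp.1
    have hp2 : column r c q p = j := congrArg Fin.val hp.2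
    have := hc.lt_of_slot p
    rw [hp1] at this
    rw [column, hp1] at hp2
    exact h ⟨this, hp2⟩

lemma IsEvenChain.eq_of_diff {c' : ℕ → ℕ → ℕ} (hc : IsEvenChain r c) (hc' : IsEvenChain r c')
    (h : ∀ t j : Fin (2 * r), c (j + 1) t - c j t = c' (j + 1) t - c' j t) {j : ℕ}
    (hj : j ≤ 2 * r) : c j = c' j := by
  induction j with
  | zero => funext t; rw [hc.zero, hc'.zero]
  | succ j ih =>
    funext t
    by_cases ht : t < 2 * r
    · have := h ⟨t, ht⟩ ⟨j, hj⟩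
      have e := congrFun (ih (by omega)) t
      have h1 := (hc.interlaces j t).2
      have h2 := (hc'.interlaces j t).2
      simp only at this
      omega
    · rw [hc.eq_zero (by omega), hc'.eq_zero (by omega)]

end Chains

section Independence

open MvPolynomial

/-- Nonzero polynomials with pairwise distinct leading monomials are linearly independent. -/
lemma linearIndependent_of_degree_injective {σ ι F : Type*} [Field F] (m : MonomialOrder σ)
    (f : ι → MvPolynomial σ F) (h0 : ∀ i, f i ≠ 0)
    (hinj : Function.Injective fun i => m.degree (f i)) : LinearIndependent F f := by
  classical
  rw [linearIndependent_iff']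
  intro s g hg
  by_contra! hex
  obtain ⟨i₀, hi₀, hmax⟩ := Finset.exists_max_image (s.filter fun i => g i ≠ 0)
    (fun i => m.toSyn (m.degree (f i))) (by
      obtain ⟨i, hi, hgi⟩ := hex
      exact ⟨i, Finset.mem_filter.2 ⟨hi, hgi⟩⟩)
  rw [Finset.mem_filter] at hi₀
  have := congrArg (coeff (m.degree (f i₀))) hg
  rw [coeff_sum, coeff_zero, Finset.sum_eq_single_of_mem i₀ hi₀.1] at this
  · rw [coeff_smul, smul_eq_mul] at this
    rcases mul_eq_zero.1 this with h | h
    · exact hi₀.2 h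
    · exact m.leadingCoeff_ne_zero_iff.2 (h0 i₀) h
  · intro i hi hne
    rw [coeff_smul, smul_eq_mul]
    by_cases hgi : g i = 0
    · rw [hgi, zero_mul]
    · rw [m.coeff_eq_zero_of_lt, mul_zero]
      refine lt_of_le_of_ne (hmax i (Finset.mem_filter.2 ⟨hi, hgi⟩)) fun h => hne ?_
      exact hinj (m.toSyn.injective h)

end Independence

section GenericBasis

open MvPolynomial

/-- The positions strictly above the diagonal. -/
abbrev Upper (n : ℕ) := {p : Fin n × Fin n // p.1 < p.2}

/-- The extension by zero of a function on the positions above the diagonal. -/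
def upperExt {M : Type*} [Zero M] {n : ℕ} (f : Upper n → M) (i j : ℕ) : M :=
  if h : i < j ∧ j < n then f ⟨(⟨i, h.1.trans h.2⟩, ⟨j, h.2⟩), h.1⟩ else 0

lemma upperExt_self {M : Type*} [Zero M] {n : ℕ} (f : Upper n → M) (i : ℕ) :
    upperExt f i i = 0 := dif_neg (by omega)

lemma upperExt_val {M : Type*} [Zero M] {n : ℕ} (f : Upper n → M) (e : Upper n) :
    upperExt f e.1.1 e.1.2 = f e := dif_pos ⟨e.2, e.1.2.2⟩

lemma sum_upperExt {M N : Type*} [Zero M] [AddCommMonoid N] {n : ℕ} (f : Upper n → M)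
    (g : M → ℕ → ℕ → N) (hg : ∀ i j, g 0 i j = 0) :
    ∑ i ∈ Finset.range n, ∑ j ∈ Finset.range n, g (upperExt f i j) i j =
      ∑ e, g (f e) e.1.1 e.1.2 := by
  classical
  rw [Finset.sum_range]
  simp_rw [Finset.sum_range]
  rw [← Fintype.sum_prod_type' (f := fun i j : Fin n => g (upperExt f i j) i j)]
  simp_rw [← upperExt_val f]
  rw [← Finset.sum_subtype (Finset.univ.filter fun p : Fin n × Fin n => p.1 < p.2) (by simp)
    (fun p : Fin n × Fin n => g (upperExt f p.1 p.2) p.1 p.2)]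
  symm
  refine Finset.sum_filter_of_ne fun p _ hne => ?_
  by_contra h
  exact hne (by rw [upperExt, dif_neg fun h' => h h'.1, hg])

/-- The symmetric matrix with zero diagonal and the given entries above it. -/
def symExt {n : ℕ} (d : Upper n → ℕ) (i j : ℕ) : ℕ := upperExt d i j + upperExt d j i

/-- The generic alternating matrix. -/
def genSkew (n : ℕ) (F : Type*) [Field F] (i j : ℕ) : MvPolynomial (Upper n) F :=
  upperExt X i j - upperExt X j i

/-- The chain attached to an exponent. -/
def chainOf {r : ℕ} (d : Upper (2 * r) →₀ ℕ) (j : ℕ) : ℕ → ℕ := grow (symExt d) j (2 * r)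

variable {r : ℕ}

lemma symExt_symm {n : ℕ} (d : Upper n → ℕ) (i j : ℕ) : symExt d i j = symExt d j i := by
  rw [symExt, symExt, add_comm]

lemma symExt_self {n : ℕ} (d : Upper n → ℕ) (i : ℕ) : symExt d i i = 0 := by
  rw [symExt, upperExt_self, add_zero]

lemma isEvenChain_chainOf (d : Upper (2 * r) →₀ ℕ) : IsEvenChain r (chainOf d) where
  zero t := grow_zero_left _ _ t
  interlaces j := (grow_interlaces j (2 * r)).2
  even u := grow_diag (symExt_symm _) (symExt_self _) (2 * r) u

lemma eq_of_chainOf_eq {d d' : Upper (2 * r) →₀ ℕ} (h : ∀ j ≤ 2 * r, chainOf d j = chainOf d' j) :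
    d = d' := by
  ext e
  have := grow_injective (symExt_symm d) (symExt_symm d') h e.1.1.2 e.1.2.2
  rw [symExt, symExt, upperExt_val, upperExt_val] at this
  have h0 : ∀ f : Upper (2 * r) → ℕ, upperExt f e.1.2 e.1.1 = 0 := fun f =>
    dif_neg fun h => by have h2 : (e.1.1 : ℕ) < e.1.2 := e.2; omega
  rw [h0, h0] at this
  simpa using this

section Weight

/-- The total weight of the letters of the tableau encoded by the chain `c`. -/
def chainWt (r : ℕ) (c : ℕ → ℕ → ℕ) (v : ℕ → ℕ) : ℕ :=
  ∑ q ∈ Finset.range (c (2 * r) 0), ∑ p, v (column r c q p)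

lemma sum_slots {M : Type*} [AddCommMonoid M] (s : ℕ) (f : ℕ → M) :
    ∑ p : Fin s × Fin 2, f (2 * p.1 + p.2) = ∑ t ∈ Finset.range (2 * s), f t := by
  rw [Fintype.sum_prod_type]
  simp only [Fin.sum_univ_two, Fin.val_zero, Fin.val_one, add_zero]
  rw [Fin.sum_univ_eq_sum_range (fun u => f (2 * u) + f (2 * u + 1))]
  induction s with
  | zero => simp
  | succ s ih =>
    rw [Finset.sum_range_succ, ih, Nat.mul_succ, Finset.sum_range_succ, Finset.sum_range_succ,
      add_assoc]

lemma IsEvenChain.chainWt_eq {c : ℕ → ℕ → ℕ} (hc : IsEvenChain r c) (v : ℕ → ℕ) :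
    chainWt r c v = ∑ j ∈ Finset.range (2 * r),
      (∑ t ∈ Finset.range (2 * r), (c (j + 1) t - c j t)) * v j := by
  have h1 : ∀ q, ∑ p, v (column r c q p) = ∑ j ∈ Finset.range (2 * r),
      ∑ t ∈ Finset.range (2 * r), if q < c (2 * r) t ∧ colLetter c q t = j then v j else 0 := by
    intro q
    simp only [column]
    rw [sum_slots _ fun t => v (colLetter c q t), Finset.sum_comm]
    rw [← Finset.sum_subset (Finset.range_subset_range.2
      (Nat.mul_le_mul_left 2 (hc.colSize_le q)))]
    · refine Finset.sum_congr rfl fun t ht => ?_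
      have ht := hc.lt_colSize_iff.1 (Finset.mem_range.1 ht)
      simp only [ht, true_and]
      rw [Finset.sum_ite_eq, if_pos (Finset.mem_range.2 (hc.colLetter_spec ht).2.2)]
    · intro t _ ht
      rw [Finset.mem_range, hc.lt_colSize_iff] at ht
      simp [ht]
  rw [chainWt, Finset.sum_congr rfl fun q _ => h1 q, Finset.sum_comm]
  refine Finset.sum_congr rfl fun j hj => ?_
  rw [Finset.sum_comm, Finset.sum_mul]
  refine Finset.sum_congr rfl fun t _ => ?_
  rw [← hc.count (Finset.mem_range.1 hj), ← Finset.sum_filter, Finset.sum_const, smul_eq_mul]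

lemma chainWt_chainOf (d : Upper (2 * r) →₀ ℕ) (v : ℕ → ℕ) :
    chainWt r (chainOf d) v =
      Finsupp.weight (fun e : Upper (2 * r) => v e.1.1 + v e.1.2) d := by
  have h : ∀ j ∈ Finset.range (2 * r), ∑ t ∈ Finset.range (2 * r),
      (chainOf d (j + 1) t - chainOf d j t) = ∑ b ∈ Finset.range (2 * r), symExt d j b := by
    intro j hj
    have h1 := sum_grow_row (m := symExt d) j (2 * r) (2 * r) (Finset.mem_range.1 hj)
    rw [Finset.sum_tsub_distrib]
    · simp only [chainOf]
      omega
    · intro t _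
      exact ((isEvenChain_chainOf d).interlaces j t).2
  rw [(isEvenChain_chainOf d).chainWt_eq, Finset.sum_congr rfl fun j hj => by rw [h j hj]]
  rw [Finsupp.weight_apply, Finsupp.sum_fintype _ _ (by simp)]
  rw [← sum_upperExt (M := ℕ) d (fun a i j => a • (v i + v j)) (by simp)]
  simp only [symExt, Finset.sum_add_distrib, add_mul, Finset.sum_mul, smul_eq_mul, mul_add]
  congr 1
  exact Finset.sum_comm

end Weight

variable {F : Type*} [Field F]

lemma isWeightedHomogeneous_genSkew (n : ℕ) (v : ℕ → ℕ) (i j : ℕ) :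
    IsWeightedHomogeneous (fun e : Upper n => v e.1.1 + v e.1.2) (genSkew n F i j)
      (v i + v j) := by
  have h : ∀ i j, IsWeightedHomogeneous (fun e : Upper n => v e.1.1 + v e.1.2)
      (upperExt (X (R := F)) i j) (v i + v j) := by
    intro i j
    rw [upperExt]
    split_ifs with h
    · exact isWeightedHomogeneous_X F (fun e : Upper n => v e.1.1 + v e.1.2) _
    · exact isWeightedHomogeneous_zero F _ _
  rw [genSkew]
  refine (h i j).sub ?_
  rw [add_comm]
  exact h j i

lemma isWeightedHomogeneous_slotPf {U : Type*} [Fintype U] [DecidableEq U] (n : ℕ) (v : ℕ → ℕ)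
    (K : U × Fin 2 → ℕ) :
    IsWeightedHomogeneous (fun e : Upper n => v e.1.1 + v e.1.2) (slotPf (genSkew n F) K)
      (∑ p, v (K p)) := by
  rw [slotPf]
  refine IsWeightedHomogeneous.sum _ _ _ fun σ _ => ?_
  have h : ∑ p, v (K p) = ∑ u, (v (K (σ (u, 0))) + v (K (σ (u, 1)))) := by
    rw [← Equiv.sum_comp σ, Fintype.sum_prod_type]
    simp only [Fin.sum_univ_two]
  rw [h, ← map_intCast (C : F →+* MvPolynomial (Upper n) F)]
  refine IsWeightedHomogeneous.C_mul ?_ _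
  exact IsWeightedHomogeneous.prod _ _ _ fun u _ => isWeightedHomogeneous_genSkew n v _ _

lemma isWeightedHomogeneous_chainProd (c : ℕ → ℕ → ℕ) (v : ℕ → ℕ) :
    IsWeightedHomogeneous (fun e : Upper (2 * r) => v e.1.1 + v e.1.2)
      (chainProd r c (genSkew (2 * r) F)) (chainWt r c v) :=
  IsWeightedHomogeneous.prod _ _ _ fun _ _ => isWeightedHomogeneous_slotPf _ _ _

lemma aeval_genSkew {R : Type*} [CommRing R] [Algebra F R] {n : ℕ} (B : ℕ → ℕ → R)
    (hskew : ∀ i j, B i j = -B j i) (hdiag : ∀ i, B i i = 0) (hout : ∀ i j, n ≤ j → B i j = 0)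
    (i j : ℕ) : aeval (fun e : Upper n => B e.1.1 e.1.2) (genSkew n F i j) = B i j := by
  have hup : ∀ i j, aeval (fun e : Upper n => B e.1.1 e.1.2) (upperExt (X (R := F)) i j) =
      if i < j then B i j else 0 := by
    intro i j
    rw [upperExt]
    split_ifs with h h' h'
    · rw [aeval_X]
    · exact absurd h.1 h'
    · rw [map_zero, hout _ _ (by omega)]
    · rw [map_zero]
  rw [genSkew, map_sub, hup, hup]
  rcases lt_trichotomy i j with h | rfl | h
  · rw [if_pos h, if_neg (by omega), sub_zero]
  · rw [hdiag]; simp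
  · rw [if_neg (by omega), if_pos h, zero_sub, hskew i j]

lemma genP_eq_zero {N : ℕ} {al : ℕ → ℕ → Prop} {t j : ℕ} (hj : N ≤ j) :
    genP N F al t j = 0 := dif_neg (by omega)

lemma linearIndependent_chainProd_sympForm (al : ℕ → ℕ → Prop)
    (hF : ∀ k, 0 < k → k ≤ r → (k : F) ≠ 0) (h2 : (2 : F) ≠ 0) :
    LinearIndependent F fun d : {d : Upper (2 * r) →₀ ℕ //
        ∀ q t, q < chainOf d (2 * r) t → al t (colLetter (chainOf d) q t)} =>
      chainProd r (chainOf d.1) (sympForm r (genP (2 * r) F al)) := by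
  refine linearIndependent_of_degree_injective MonomialOrder.lex _
    (fun d => ((isEvenChain_chainOf d.1).leading hF h2 d.2).1) fun d d' h => ?_
  refine Subtype.ext (eq_of_chainOf_eq fun j hj => ?_)
  refine (isEvenChain_chainOf d.1).eq_of_diff (isEvenChain_chainOf d'.1) (fun t j => ?_) hj
  rw [← ((isEvenChain_chainOf d.1).leading hF h2 d.2).2,
    ← ((isEvenChain_chainOf d'.1).leading hF h2 d'.2).2]
  exact DFunLike.congr_fun h _

lemma linearIndependent_chainProd_genSkew
    (hF : ∀ k, 0 < k → k ≤ r → (k : F) ≠ 0) (h2 : (2 : F) ≠ 0) :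
    LinearIndependent F fun d : Upper (2 * r) →₀ ℕ =>
      chainProd r (chainOf d) (genSkew (2 * r) F) := by
  let B : ℕ → ℕ → MvPolynomial (Fin (2 * r) ×ₗ Fin (2 * r)) F :=
    sympForm r (genP (2 * r) F fun _ _ => True)
  refine LinearIndependent.of_comp
    (aeval (R := F) fun e : Upper (2 * r) => B e.1.1 e.1.2).toLinearMap ?_
  have h := (linearIndependent_chainProd_sympForm (r := r) (F := F)
    (fun _ _ => True) hF h2).comp (fun d => ⟨d, fun _ _ _ => trivial⟩) (fun d d' h => by
      simpa using h)
  have hmap : ∀ d : Upper (2 * r) →₀ ℕ, (aeval (R := F) fun e : Upper (2 * r) => B e.1.1 e.1.2)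
      (chainProd r (chainOf d) (genSkew (2 * r) F)) = chainProd r (chainOf d) B := by
    intro d
    change (aeval (R := F) fun e : Upper (2 * r) => B e.1.1 e.1.2).toRingHom _ = _
    rw [chainProd_map]
    congr 1
    funext i j
    refine aeval_genSkew B (fun i j => ?_) (fun i => ?_) (fun i j hj => ?_) i j
    · simp only [B, sympForm, ← Finset.sum_neg_distrib]
      exact Finset.sum_congr rfl fun q _ => by ring
    · simp only [B, sympForm]
      exact Finset.sum_eq_zero fun q _ => by ring
    · simp only [B, sympForm]
      exact Finset.sum_eq_zero fun q _ => by rw [genP_eq_zero hj, genP_eq_zero hj]; ring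
  have hfun : ((aeval (R := F) fun e : Upper (2 * r) => B e.1.1 e.1.2).toLinearMap ∘
      fun d : Upper (2 * r) →₀ ℕ => chainProd r (chainOf d) (genSkew (2 * r) F)) =
      fun d => chainProd r (chainOf d) B := funext hmap
  rw [hfun]
  exact h

/-- The chain products of a given positive weight span the polynomials of that weight. -/
lemma mem_span_chainProd (hF : ∀ k, 0 < k → k ≤ r → (k : F) ≠ 0) (h2 : (2 : F) ≠ 0)
    (v : ℕ → ℕ) (hv : ∀ j < 2 * r, 0 < v j) (γ : ℕ) (p : MvPolynomial (Upper (2 * r)) F)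
    (hp : IsWeightedHomogeneous (fun e : Upper (2 * r) => v e.1.1 + v e.1.2) p γ) :
    p ∈ Submodule.span F ((fun d : Upper (2 * r) →₀ ℕ => chainProd r (chainOf d) (genSkew (2 * r) F)) ''
      {d : Upper (2 * r) →₀ ℕ | chainWt r (chainOf d) v = γ}) := by
  classical
  set w := fun e : Upper (2 * r) => v e.1.1 + v e.1.2 with hw
  have hfin : {d : Upper (2 * r) →₀ ℕ | Finsupp.weight w d = γ}.Finite := by
    refine Finsupp.finite_of_nat_weight_eq w (fun e => ?_) γ
    have := hv e.1.1 e.1.1.2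
    simp only [hw]
    omega
  have hset : {d : Upper (2 * r) →₀ ℕ | chainWt r (chainOf d) v = γ} =
      {d : Upper (2 * r) →₀ ℕ | Finsupp.weight w d = γ} := by
    ext d
    simp only [Set.mem_ofPred_eq]
    rw [chainWt_chainOf]
  rw [hset]
  set D := {d : Upper (2 * r) →₀ ℕ | Finsupp.weight w d = γ} with hD
  have : Fintype D := hfin.fintype
  let H := weightedHomogeneousSubmodule F w γ
  let eqv : H ≃ₗ[F] (D →₀ F) :=
    (LinearEquiv.ofEq _ _ (weightedHomogeneousSubmodule_eq_finsupp_supported F w γ)).trans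
      (AddMonoidAlgebra.supportedEquivFinsupp D)
  have hfd : FiniteDimensional F H := eqv.symm.finiteDimensional
  have hrank : Module.finrank F H = Fintype.card D := by
    rw [eqv.finrank_eq, Module.finrank_finsupp_self]
  have hli := (linearIndependent_chainProd_genSkew (r := r) (F := F) hF h2).comp
    (Subtype.val : D → _) Subtype.val_injective
  have hle : Submodule.span F ((fun d : Upper (2 * r) →₀ ℕ => chainProd r (chainOf d) (genSkew (2 * r) F)) '' D) ≤ H := by
    rw [Submodule.span_le]
    rintro _ ⟨d, hd, rfl⟩
    have h := isWeightedHomogeneous_chainProd (r := r) (F := F) (chainOf d) v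
    rw [← hset] at hd
    have hd : chainWt r (chainOf d) v = γ := hd
    rw [hd] at h
    exact h
  have heq : Submodule.span F ((fun d : Upper (2 * r) →₀ ℕ => chainProd r (chainOf d) (genSkew (2 * r) F)) '' D) = H := by
    refine Submodule.eq_of_le_of_finrank_eq hle ?_
    rw [hrank, ← finrank_span_eq_card hli, Set.range_comp, Subtype.range_coe]
  rw [heq]
  exact hp

end GenericBasis

section Straightening

open Finset

/-- If all sums of `f` over the `q`-sets containing a given `(q - 1)`-set vanish and `N < 2 * q`,
where `N` is the size of the ground set, then `f` vanishes. -/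
lemma eq_zero_of_sum_insert_eq_zero {F V α : Type*} [Field F] [AddCommGroup V] [Module F V]
    [DecidableEq α] (T : Finset α) (f : Finset α → V) (q : ℕ)
    (hq : ∀ k, 0 < k → k ≤ q → (k : F) ≠ 0) (hT : T.card < 2 * q)
    (hf : ∀ Y ⊆ T, Y.card + 1 = q → ∑ l ∈ T \ Y, f (insert l Y) = 0)
    {D : Finset α} (hD : D ⊆ T) (hDq : D.card = q) : f D = 0 := by
  set C := T \ D with hC
  have hCq : C.card < q := by
    rw [hC, card_sdiff_of_subset hD]
    omega
  let g : ℕ → V := fun i => ∑ Z ∈ powersetCard q T, if (Z ∩ C).card = i then f Z else 0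
  have hcount : ∀ Z ∈ powersetCard q T, ∀ i,
      (((Z.filter fun l => ((Z.erase l) ∩ C).card = i).card : ℕ) : F) • f Z =
      ((q : F) - i) • (if (Z ∩ C).card = i then f Z else 0) +
        ((i : F) + 1) • (if (Z ∩ C).card = i + 1 then f Z else 0) := by
    intro Z hZ i
    rw [mem_powersetCard] at hZ
    have hcard : ∀ l ∈ Z, ((Z.erase l) ∩ C).card = i ↔
        (l ∉ C ∧ (Z ∩ C).card = i) ∨ (l ∈ C ∧ (Z ∩ C).card = i + 1) := by
      intro l hl
      rw [erase_inter]
      by_cases hlC : l ∈ C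
      · have := card_pos.2 ⟨l, mem_inter.2 ⟨hl, hlC⟩⟩
        rw [card_erase_of_mem (mem_inter.2 ⟨hl, hlC⟩)]
        simp only [hlC, not_true_eq_false, false_and, true_and, false_or]
        omega
      · rw [erase_eq_of_notMem (fun h => hlC (mem_inter.1 h).2)]
        simp [hlC]
    rw [filter_congr hcard]
    by_cases h1 : (Z ∩ C).card = i
    · have e : (Z.filter fun l => (l ∉ C ∧ (Z ∩ C).card = i) ∨ (l ∈ C ∧ (Z ∩ C).card = i + 1)) =
          Z \ C := by
        ext l
        simp [h1]
      have h2 := card_sdiff_add_card_inter Z C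
      rw [e, if_pos h1, if_neg (by omega), smul_zero, add_zero]
      congr 1
      have h3 : (Z \ C).card + i = q := by omega
      rw [← h3]
      push_cast
      ring
    · by_cases h2 : (Z ∩ C).card = i + 1
      · have e : (Z.filter fun l => (l ∉ C ∧ (Z ∩ C).card = i) ∨
            (l ∈ C ∧ (Z ∩ C).card = i + 1)) = Z ∩ C := by
          ext l
          simp [h2]
        rw [e, if_neg h1, if_pos h2, smul_zero, zero_add, h2]
        push_cast
        rfl
      · rw [if_neg h1, if_neg h2]
        simp [h1, h2]
  have hrec : ∀ i, i + 1 ≤ q → ((q : F) - i) • g i + ((i : F) + 1) • g (i + 1) = 0 := by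
    intro i hi
    simp only [g, smul_sum, ← sum_add_distrib]
    rw [← sum_congr rfl fun Z hZ => hcount Z hZ i]
    have h0 : ∑ Y ∈ (powersetCard (q - 1) T).filter (fun Y => (Y ∩ C).card = i),
        ∑ l ∈ T \ Y, f (insert l Y) = 0 := by
      refine sum_eq_zero fun Y hY => ?_
      rw [mem_filter, mem_powersetCard] at hY
      exact hf Y hY.1.1 (by omega)
    rw [← h0]
    have h1 : ∀ Z : Finset α, (((Z.filter fun l => ((Z.erase l) ∩ C).card = i).card : ℕ) : F) • f Z =
        ∑ l ∈ Z.filter fun l => ((Z.erase l) ∩ C).card = i, f Z := by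
      intro Z
      rw [sum_const, Nat.cast_smul_eq_nsmul]
    rw [sum_congr rfl fun Z _ => h1 Z, sum_sigma', sum_sigma']
    refine sum_bij' (fun x _ => ⟨x.1.erase x.2, x.2⟩) (fun x _ => ⟨insert x.2 x.1, x.2⟩)
      ?_ ?_ ?_ ?_ ?_
    · rintro ⟨Z, l⟩ h
      simp only [mem_sigma, mem_filter, mem_powersetCard, mem_sdiff] at h ⊢
      obtain ⟨⟨h1, h2⟩, h3, h4⟩ := h
      refine ⟨⟨⟨(erase_subset _ _).trans h1, ?_⟩, h4⟩, h1 h3, notMem_erase _ _⟩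
      rw [card_erase_of_mem h3, h2]
    · rintro ⟨Y, l⟩ h
      simp only [mem_sigma, mem_filter, mem_powersetCard, mem_sdiff] at h ⊢
      obtain ⟨⟨⟨h1, h2⟩, h3⟩, h4, h5⟩ := h
      refine ⟨⟨insert_subset h4 h1, ?_⟩, mem_insert_self _ _, ?_⟩
      · rw [card_insert_of_notMem h5]
        omega
      · rwa [erase_insert h5]
    · rintro ⟨Z, l⟩ h
      simp only [mem_sigma, mem_filter] at h
      simp only [insert_erase h.2.1]
    · rintro ⟨Y, l⟩ h
      simp only [mem_sigma, mem_sdiff] at h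
      simp only [erase_insert h.2.2]
    · rintro ⟨Z, l⟩ h
      simp only [mem_sigma, mem_filter] at h
      simp only [insert_erase h.2.1]
  have hg : ∀ k, k ≤ q → g (q - k) = 0 := by
    intro k
    induction k with
    | zero =>
      intro _
      refine sum_eq_zero fun Z _ => if_neg fun h => ?_
      have := card_le_card (inter_subset_right (s₁ := Z) (s₂ := C))
      omega
    | succ k ih =>
      intro hk
      have h := hrec (q - (k + 1)) (by omega)
      rw [show q - (k + 1) + 1 = q - k by omega, ih (by omega), smul_zero, add_zero,
        ← Nat.cast_sub (by omega), show q - (q - (k + 1)) = k + 1 by omega] at h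
      exact (smul_eq_zero.1 h).resolve_left (hq _ (by omega) hk)
  have := hg q le_rfl
  rw [Nat.sub_self] at this
  rw [← this]
  simp only [g]
  rw [sum_eq_single_of_mem D (mem_powersetCard.2 ⟨hD, hDq⟩), if_pos]
  · rw [hC, inter_sdiff_self, card_empty]
  · intro Z hZ hne
    rw [mem_powersetCard] at hZ
    refine if_neg fun h => hne ?_
    rw [card_eq_zero, hC] at h
    refine eq_of_subset_of_card_le (fun z hz => ?_) (by omega)
    by_contra hzD
    exact notMem_empty z (h ▸ mem_inter.2 ⟨hz, mem_sdiff.2 ⟨hZ.1 hz, hzD⟩⟩)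

/-- The letters `2 * l` and `2 * l + 1` for `l ∈ Z`, together with the letters `K`. -/
def pairSlot {V : Type*} (K : V × Fin 2 → ℕ) (Z : Finset ℕ) : (Z ⊕ V) × Fin 2 → ℕ
  | (Sum.inl l, x) => 2 * l + x
  | (Sum.inr v, x) => K (v, x)

variable {V : Type*} (K : V × Fin 2 → ℕ)

lemma pairSlot_not_injective {Z : Finset ℕ} {l : ℕ} (hl : l ∈ Z) {x : Fin 2}
    (h : 2 * l + (x : ℕ) ∈ Set.range K) : ¬ Function.Injective (pairSlot K Z) := by
  intro hinj
  obtain ⟨⟨v, y⟩, h⟩ := h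
  have := @hinj (Sum.inl ⟨l, hl⟩, x) (Sum.inr v, y) h.symm
  simp at this

lemma pairSlot_injective {Z : Finset ℕ} (hK : Function.Injective K)
    (h : ∀ l ∈ Z, ∀ x : Fin 2, 2 * l + (x : ℕ) ∉ Set.range K) :
    Function.Injective (pairSlot K Z) := by
  rintro ⟨l | v, x⟩ ⟨l' | v', x'⟩ e
  · have e : 2 * (l : ℕ) + x = 2 * l' + x' := e
    have h1 : l = l' := Subtype.ext (by omega)
    have h2 : x = x' := by ext; rw [h1] at e; omega
    rw [h1, h2]
  · exact absurd ⟨_, e.symm⟩ (h l l.2 x)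
  · exact absurd ⟨_, e⟩ (h l' l'.2 x')
  · have := hK (a₁ := (v, x)) (a₂ := (v', x')) e
    simp only [Prod.mk.injEq] at this
    rw [this.1, this.2]

lemma consSlot_pairSlot_not_injective {Y : Finset ℕ} {l : ℕ} (hl : l ∈ Y) :
    ¬ Function.Injective (consSlot (2 * l) (2 * l + 1) (pairSlot K Y)) := by
  intro hinj
  have := @hinj (none, 0) (some (Sum.inl ⟨l, hl⟩), 0) (by simp [consSlot, pairSlot])
  simp at this

lemma slotPf_consSlot_pairSlot {R : Type*} [CommRing R] (A : ℕ → ℕ → R) [Fintype V]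
    [DecidableEq V] {Y : Finset ℕ} {l : ℕ} (hl : l ∉ Y) :
    slotPf A (consSlot (2 * l) (2 * l + 1) (pairSlot K Y)) =
      slotPf A (pairSlot K (insert l Y)) := by
  let e : Option (Y ⊕ V) → (insert l Y : Finset ℕ) ⊕ V := fun o => match o with
    | none => Sum.inl ⟨l, mem_insert_self _ _⟩
    | some (Sum.inl y) => Sum.inl ⟨y, mem_insert_of_mem y.2⟩
    | some (Sum.inr v) => Sum.inr v
  have he : Function.Bijective e := by
    constructor
    · rintro (_ | y | v) (_ | y' | v') h
      · rfl
      · simp only [e, Sum.inl.injEq, Subtype.mk.injEq] at h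
        exact absurd (h ▸ y'.2) hl
      · simp [e] at h
      · simp only [e, Sum.inl.injEq, Subtype.mk.injEq] at h
        exact absurd (h ▸ y.2) hl
      · simp only [e, Sum.inl.injEq, Subtype.mk.injEq] at h
        rw [Subtype.ext h]
      · simp [e] at h
      · simp [e] at h
      · simp [e] at h
      · simpa [e] using h
    · rintro (⟨y, hy⟩ | v)
      · rcases mem_insert.1 hy with rfl | h
        · exact ⟨none, rfl⟩
        · exact ⟨some (Sum.inl ⟨y, h⟩), rfl⟩
      · exact ⟨some (Sum.inr v), rfl⟩
  rw [← slotPf_reindex A (pairSlot K (insert l Y)) (Equiv.ofBijective e he)]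
  congr 1
  funext ⟨o, x⟩
  rcases o with _ | y | v
  · fin_cases x <;> simp [consSlot, e, pairSlot]
  · simp [consSlot, e, pairSlot]
  · simp [consSlot, e, pairSlot]

lemma sum_pairSlot [Fintype V] (Z : Finset ℕ) :
    ∑ p, 2 ^ (pairSlot K Z p / 2) = 2 * ∑ l ∈ Z, 2 ^ l + ∑ p, 2 ^ (K p / 2) := by
  rw [Fintype.sum_prod_type, Fintype.sum_sum_type, Fintype.sum_prod_type, mul_sum, ← sum_coe_sort Z]
  congr 1
  refine sum_congr rfl fun l _ => ?_
  rw [Fin.sum_univ_two]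
  simp only [pairSlot, Fin.val_zero, Fin.val_one]
  rw [show (2 * (l : ℕ) + 0) / 2 = l by omega, show (2 * (l : ℕ) + 1) / 2 = l by omega]
  ring

/-- A column in which more than `t` letters are less than `2 * t` is a combination of columns of
larger weight. -/
lemma slotPf_mem_span_of_crowded {F R : Type*} [Field F] [CommRing R] [Algebra F R] {r : ℕ}
    {A : ℕ → ℕ → R} (hA : IsNullSkew r A) (h2 : (2 : F) ≠ 0)
    (hF : ∀ k, 0 < k → k ≤ r → (k : F) ≠ 0) {s : ℕ} (K : Fin s × Fin 2 → ℕ)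
    (hK : Function.Injective K) (hlt : ∀ p, K p < 2 * r) {t : ℕ} (htr : t ≤ r)
    (ht : t < (univ.filter fun p => K p < 2 * t).card) :
    slotPf A K ∈ Submodule.span F {x | ∃ K' : Fin s × Fin 2 → ℕ, x = slotPf A K' ∧
      (∀ p, K' p < 2 * r) ∧ ∑ p, 2 ^ (K p / 2) < ∑ p, 2 ^ (K' p / 2)} := by
  classical
  set M := Submodule.span F {x | ∃ K' : Fin s × Fin 2 → ℕ, x = slotPf A K' ∧
      (∀ p, K' p < 2 * r) ∧ ∑ p, 2 ^ (K p / 2) < ∑ p, 2 ^ (K' p / 2)} with hM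
  set L := univ.image K with hL
  have hLcard : L.card = 2 * s := by
    rw [hL, card_image_of_injective _ hK]
    simp [mul_comm]
  set D := (range t).filter fun l => 2 * l ∈ L ∧ 2 * l + 1 ∈ L with hD
  have hDt : ∀ l ∈ D, l < t := fun l hl => mem_range.1 (mem_filter.1 hl).1
  let P := D.image (fun l => 2 * l) ∪ D.image (fun l => 2 * l + 1)
  have hP : ∀ x, x ∈ P ↔ x / 2 ∈ D := by
    intro x
    simp only [P, mem_union, mem_image]
    constructor
    · rintro (⟨l, hl, rfl⟩ | ⟨l, hl, rfl⟩)
      · rwa [show 2 * l / 2 = l by omega]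
      · rwa [show (2 * l + 1) / 2 = l by omega]
    · intro h
      rcases Nat.mod_two_eq_zero_or_one x with h' | h'
      · exact Or.inl ⟨_, h, by omega⟩
      · exact Or.inr ⟨_, h, by omega⟩
  have hPL : P ⊆ L := by
    intro x hx
    have := (mem_filter.1 ((hP x).1 hx)).2
    rcases Nat.mod_two_eq_zero_or_one x with h' | h'
    · rw [show x = 2 * (x / 2) by omega]; exact this.1
    · rw [show x = 2 * (x / 2) + 1 by omega]; exact this.2
  have hPcard : P.card = 2 * D.card := by
    rw [card_union_of_disjoint, card_image_of_injective, card_image_of_injective]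
    · ring
    · intro a b h
      simp only at h
      omega
    · intro a b h
      simp only at h
      omega
    · rw [disjoint_left]
      simp only [mem_image, not_exists, not_and]
      rintro _ ⟨a, _, rfl⟩ b _
      omega
  have hDs : D.card ≤ s := by
    have := card_le_card hPL
    omega
  have hVcard : Fintype.card (Fin (s - D.card) × Fin 2) = Fintype.card ↥(L \ P) := by
    rw [Fintype.card_coe, card_sdiff_of_subset hPL]
    simp only [Fintype.card_prod, Fintype.card_fin]
    omega
  let E := Fintype.equivOfCardEq hVcard
  let Q : Fin (s - D.card) × Fin 2 → ℕ := fun p => E p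
  have hQ : Function.Injective Q := Subtype.val_injective.comp E.injective
  have hQr : ∀ x, x ∈ Set.range Q ↔ x ∈ L ∧ x / 2 ∉ D := by
    intro x
    rw [← hP, ← mem_sdiff]
    constructor
    · rintro ⟨p, rfl⟩
      exact (E p).2
    · intro hx
      exact ⟨E.symm ⟨x, hx⟩, by simp [Q]⟩
  have hLr : ∀ x ∈ L, x < 2 * r := by
    intro x hx
    obtain ⟨p, -, rfl⟩ := mem_image.1 hx
    exact hlt p
  have hQlt : ∀ p, Q p < 2 * r := fun p => hLr _ ((hQr _).1 ⟨p, rfl⟩).1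
  set T := (range t).filter fun l => 2 * l ∉ Set.range Q ∧ 2 * l + 1 ∉ Set.range Q with hT
  have hTt : ∀ l ∈ T, l < t := fun l hl => mem_range.1 (mem_filter.1 hl).1
  have hDT : D ⊆ T := by
    intro l hl
    rw [hT, mem_filter, hQr, hQr, show 2 * l / 2 = l by omega, show (2 * l + 1) / 2 = l by omega]
    exact ⟨(mem_filter.1 hl).1, fun h => h.2 hl, fun h => h.2 hl⟩
  have hTcard : T.card < 2 * D.card := by
    have h1 : (univ.filter fun p => K p < 2 * t).card =
        ∑ l ∈ range t, ((if 2 * l ∈ L then 1 else 0) + if 2 * l + 1 ∈ L then 1 else 0) := by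
      rw [← card_image_of_injective _ hK]
      have : (univ.filter fun p => K p < 2 * t).image K = (range (2 * t)).filter (· ∈ L) := by
        ext x
        simp only [mem_image, mem_filter, mem_univ, true_and, mem_range, hL]
        constructor
        · rintro ⟨p, h, rfl⟩
          exact ⟨h, p, rfl⟩
        · rintro ⟨h, p, rfl⟩
          exact ⟨p, h, rfl⟩
      rw [this, card_filter]
      clear * -
      induction t with
      | zero => simp
      | succ t ih =>
        rw [sum_range_succ, ← ih, Nat.mul_succ, sum_range_succ, sum_range_succ, add_assoc]
    have h2 : ∑ l ∈ range t, ((if 2 * l ∈ L then 1 else 0) + if 2 * l + 1 ∈ L then 1 else 0) +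
        T.card = 2 * D.card + t := by
      have h3 : D.card = ∑ l ∈ range t, if 2 * l ∈ L ∧ 2 * l + 1 ∈ L then 1 else 0 := by
        rw [hD, card_filter]
      have h4 : T.card = ∑ l ∈ range t,
          if 2 * l ∉ Set.range Q ∧ 2 * l + 1 ∉ Set.range Q then 1 else 0 := by
        rw [hT, card_filter]
      have h5 : 2 * D.card + t = ∑ l ∈ range t,
          (2 * (if 2 * l ∈ L ∧ 2 * l + 1 ∈ L then 1 else 0) + 1) := by
        rw [sum_add_distrib, ← mul_sum, ← h3]
        simp
      rw [h5, h4, ← sum_add_distrib]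
      refine sum_congr rfl fun l hl => ?_
      have hlD : l ∈ D ↔ 2 * l ∈ L ∧ 2 * l + 1 ∈ L := by
        rw [hD, mem_filter]
        exact and_iff_right hl
      have e1 : 2 * l ∈ Set.range Q ↔ 2 * l ∈ L ∧ ¬(2 * l ∈ L ∧ 2 * l + 1 ∈ L) := by
        rw [hQr, show 2 * l / 2 = l by omega, hlD]
      have e2 : 2 * l + 1 ∈ Set.range Q ↔ 2 * l + 1 ∈ L ∧ ¬(2 * l ∈ L ∧ 2 * l + 1 ∈ L) := by
        rw [hQr, show (2 * l + 1) / 2 = l by omega, hlD]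
      simp only [e1, e2]
      by_cases a : 2 * l ∈ L <;> by_cases b : 2 * l + 1 ∈ L <;> simp [a, b]
    omega
  have hrange : Set.range K = Set.range (pairSlot Q D) := by
    ext x
    have hx : x ∈ Set.range K ↔ x ∈ L := by simp [hL]
    rw [hx]
    constructor
    · intro h
      by_cases hd : x / 2 ∈ D
      · exact ⟨(Sum.inl ⟨x / 2, hd⟩, ⟨x % 2, by omega⟩), by simp only [pairSlot]; omega⟩
      · obtain ⟨p, hp⟩ := (hQr x).2 ⟨h, hd⟩
        exact ⟨(Sum.inr p.1, p.2), hp⟩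
    · rintro ⟨⟨l | v, y⟩, rfl⟩
      · refine hPL ((hP _).2 ?_)
        simp only [pairSlot]
        rw [show (2 * (l : ℕ) + y) / 2 = l by omega]
        exact l.2
      · exact ((hQr _).1 ⟨(v, y), rfl⟩).1
  have hinjD : Function.Injective (pairSlot Q D) := by
    refine pairSlot_injective Q hQ fun l hl x => ?_
    rw [hQr, show (2 * l + (x : ℕ)) / 2 = l by omega]
    exact fun h => h.2 hl
  have hwt : ∑ p, 2 ^ (K p / 2) = ∑ p, 2 ^ (pairSlot Q D p / 2) := by
    rw [← sum_image (s := univ) (g := K) (f := fun x => 2 ^ (x / 2)) (fun _ _ _ _ h => hK h),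
      ← sum_image (s := univ) (g := pairSlot Q D) (f := fun x => 2 ^ (x / 2))
        (fun _ _ _ _ h => hinjD h)]
    congr 1
    apply coe_injective
    simp only [coe_image, coe_univ, Set.image_univ]
    exact hrange
  have hmain : M.mkQ (slotPf A (pairSlot Q D)) = 0 := by
    refine eq_zero_of_sum_insert_eq_zero T (fun Z => M.mkQ (slotPf A (pairSlot Q Z))) D.card
      (fun k hk hk' => hF k hk ?_) hTcard ?_ hDT rfl
    · refine hk'.trans ((card_le_card hDT).trans ?_)
      refine (card_le_card (filter_subset _ _)).trans ?_
      rwa [card_range]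
    · intro Y hY hYc
      have hrel := sum_slotPf_consSlot hA (by
        have := (IsUnit.mk0 (2 : F) h2).map (algebraMap F R)
        rwa [map_ofNat] at this) (pairSlot Q Y)
      have hrel' := congrArg M.mkQ hrel
      rw [map_sum, map_zero] at hrel'
      rw [← hrel']
      refine sum_subset_zero_on_sdiff ?_ ?_ ?_
      · intro l hl
        rw [mem_range]
        exact (hTt l (mem_sdiff.1 hl).1).trans_le htr
      · intro l hl
        rw [mem_sdiff, mem_range, mem_sdiff] at hl
        by_cases hlY : l ∈ Y
        · rw [slotPf_eq_zero _ _ (consSlot_pairSlot_not_injective Q hlY), map_zero]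
        · rw [slotPf_consSlot_pairSlot _ _ hlY]
          have hlT : l ∉ T := fun h => hl.2 ⟨h, hlY⟩
          by_cases hlt' : l < t
          · rw [hT, mem_filter, mem_range, not_and, not_and_or, not_not, not_not] at hlT
            rcases hlT hlt' with h | h
            · rw [slotPf_eq_zero _ _ (pairSlot_not_injective Q (mem_insert_self l Y) (x := 0) h),
                map_zero]
            · rw [slotPf_eq_zero _ _ (pairSlot_not_injective Q (mem_insert_self l Y) (x := 1) h),
                map_zero]
          · rw [Submodule.mkQ_apply, Submodule.Quotient.mk_eq_zero]
            have hc : Fintype.card (Fin s) =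
                Fintype.card ((insert l Y : Finset ℕ) ⊕ Fin (s - D.card)) := by
              rw [Fintype.card_sum, Fintype.card_coe, card_insert_of_notMem hlY]
              simp only [Fintype.card_fin]
              omega
            let e := Fintype.equivOfCardEq hc
            refine Submodule.subset_span ⟨fun p => pairSlot Q (insert l Y) (e p.1, p.2),
              (slotPf_reindex _ _ _).symm, fun p => ?_, ?_⟩
            · change pairSlot Q (insert l Y) (e p.1, p.2) < 2 * r
              generalize (e p.1, p.2) = q
              obtain ⟨z | v, x⟩ := q
              · have hz : (z : ℕ) < r := by
                  rcases mem_insert.1 z.2 with h | h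
                  · rw [h]; exact hl.1
                  · exact (hTt _ (hY h)).trans_le htr
                simp only [pairSlot]
                omega
              · exact hQlt _
            · have hs : ∑ p : Fin s × Fin 2, 2 ^ (pairSlot Q (insert l Y) (e p.1, p.2) / 2) =
                  ∑ q, 2 ^ (pairSlot Q (insert l Y) q / 2) :=
                (e.prodCongr (Equiv.refl (Fin 2))).sum_comp
                  fun q => 2 ^ (pairSlot Q (insert l Y) q / 2)
              rw [hs, hwt, sum_pairSlot, sum_pairSlot, sum_insert hlY]
              have h3 : ∑ k ∈ D, 2 ^ k < 2 ^ t := Nat.geomSum_lt le_rfl hDt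
              have h4 : 2 ^ t ≤ 2 ^ l := Nat.pow_le_pow_right two_pos (not_lt.1 hlt')
              omega
      · intro l hl
        rw [slotPf_consSlot_pairSlot _ _ (mem_sdiff.1 hl).2]
  rw [Submodule.mkQ_apply, Submodule.Quotient.mk_eq_zero] at hmain
  rcases slotPf_eq_or_neg A hK hinjD hrange with h | h
  · rwa [h]
  · rw [h]
    exact M.neg_mem hmain

end Straightening

section FlaggedSpanning

open MvPolynomial

variable {F R : Type*} [Field F] [CommRing R] [Algebra F R] {r : ℕ}

/-- The symplectic condition: in each column, the letters `2 l` and `2 l + 1` occur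
at height at most `l`. -/
def IsFlagged (r : ℕ) (c : ℕ → ℕ → ℕ) : Prop :=
  ∀ q t, q < c (2 * r) t → t ≤ colLetter c q t / 2

lemma IsEvenChain.column_injective {c : ℕ → ℕ → ℕ} (hc : IsEvenChain r c) (q : ℕ) :
    Function.Injective (column r c q) := by
  intro p p' h
  have key : ∀ p p' : Fin (colSize r c q) × Fin 2, 2 * (p.1 : ℕ) + p.2 < 2 * p'.1 + p'.2 →
      column r c q p ≠ column r c q p' := fun p p' hlt =>
    (hc.colLetter_lt hlt (hc.lt_of_slot p')).ne
  have h1 : ¬ 2 * (p.1 : ℕ) + p.2 < 2 * p'.1 + p'.2 := fun hlt => key _ _ hlt h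
  have h2 : ¬ 2 * (p'.1 : ℕ) + p'.2 < 2 * p.1 + p.2 := fun hlt => key _ _ hlt h.symm
  have := p.2.2
  have := p'.2.2
  ext <;> omega

lemma IsEvenChain.crowded {c : ℕ → ℕ → ℕ} (hc : IsEvenChain r c) {q t : ℕ}
    (h : q < c (2 * r) t) (ht : colLetter c q t / 2 < t) :
    min t r < (Finset.univ.filter fun p => column r c q p < 2 * min t r).card := by
  have hs := hc.lt_colSize_iff.2 h
  rw [Finset.card_filter]
  change _ < ∑ p : Fin (colSize r c q) × Fin 2,
    if colLetter c q (2 * p.1 + p.2) < 2 * min t r then 1 else 0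
  rw [sum_slots _ fun x => if colLetter c q x < 2 * min t r then 1 else 0]
  calc min t r < ∑ x ∈ Finset.range (min t r + 1), 1 := by simp
    _ = ∑ x ∈ Finset.range (min t r + 1), if colLetter c q x < 2 * min t r then 1 else 0 := by
      refine Finset.sum_congr rfl fun x hx => (if_pos ?_).symm
      have hx' : x ≤ t := by
        have := Finset.mem_range.1 hx
        omega
      have h1 : colLetter c q x ≤ colLetter c q t := by
        rcases hx'.eq_or_lt with rfl | hlt
        · exact le_rfl
        · exact (hc.colLetter_lt hlt h).le
      have h2 := (hc.colLetter_spec h).2.2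
      omega
    _ ≤ _ := Finset.sum_le_sum_of_subset (Finset.range_mono (by omega))

/-- A matrix with the relations of `IsNullSkew` has all polynomial expressions in its entries
spanned by the flagged products of pfaffians. -/
lemma aeval_mem_span_flagged {A : ℕ → ℕ → R} (hA : IsNullSkew r A)
    (hout : ∀ i j, 2 * r ≤ j → A i j = 0) (h2 : (2 : F) ≠ 0)
    (hF : ∀ k, 0 < k → k ≤ r → (k : F) ≠ 0) (p : MvPolynomial (Upper (2 * r)) F) :
    aeval (fun e : Upper (2 * r) => A e.1.1 e.1.2) p ∈ Submodule.span F (Set.range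
      fun d : {d : Upper (2 * r) →₀ ℕ // IsFlagged r (chainOf d)} =>
        chainProd r (chainOf d.1) A) := by
  set M := Submodule.span F (Set.range
      fun d : {d : Upper (2 * r) →₀ ℕ // IsFlagged r (chainOf d)} =>
        chainProd r (chainOf d.1) A) with hM
  set ψ : MvPolynomial (Upper (2 * r)) F →ₐ[F] R :=
    aeval (fun e : Upper (2 * r) => A e.1.1 e.1.2) with hψ
  have hgen : ∀ i j, ψ (genSkew (2 * r) F i j) = A i j := aeval_genSkew A hA.skew hA.diag hout
  let u : ℕ → ℕ := fun j => 2 ^ r - 2 ^ (j / 2)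
  have hu : ∀ j < 2 * r, u j + 2 ^ (j / 2) = 2 ^ r ∧ 0 < u j := fun j hj => by
    have : 2 ^ (j / 2) < 2 ^ r := Nat.pow_lt_pow_right (by norm_num) (by omega)
    simp only [u]
    omega
  have hsum : ∀ (s : ℕ) (K : Fin s × Fin 2 → ℕ), (∀ p, K p < 2 * r) →
      ∑ p, u (K p) + ∑ p, 2 ^ (K p / 2) = 2 * s * 2 ^ r := fun s K hK => by
    rw [← Finset.sum_add_distrib, Finset.sum_congr rfl fun p _ => (hu _ (hK p)).1]
    simp [mul_comm s 2]
  have hslot : ∀ {s : ℕ} (K : Fin s × Fin 2 → ℕ),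
      ψ (slotPf (genSkew (2 * r) F) K) = slotPf A K := fun K => by
    have := slotPf_map (ψ : MvPolynomial (Upper (2 * r)) F →+* R) (genSkew (2 * r) F) K
    simpa [hgen] using this
  have main : ∀ γ p, IsWeightedHomogeneous (fun e : Upper (2 * r) => u e.1.1 + u e.1.2) p γ →
      ψ p ∈ M := by
    intro γ
    induction γ using Nat.strong_induction_on with
    | _ γ ih =>
    intro p hp
    have hp' := mem_span_chainProd hF h2 u (fun j hj => (hu j hj).2) γ p hp
    refine (Submodule.span_le (p := M.comap ψ.toLinearMap)).2 ?_ hp'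
    rintro _ ⟨d, hd, rfl⟩
    change ψ (chainProd r (chainOf d) (genSkew (2 * r) F)) ∈ M
    have hc := isEvenChain_chainOf (r := r) d
    by_cases hfl : IsFlagged r (chainOf d)
    · have := chainProd_map r (chainOf d) (genSkew (2 * r) F)
        (ψ : MvPolynomial (Upper (2 * r)) F →+* R)
      simp only [RingHom.coe_coe, hgen] at this
      rw [this]
      exact Submodule.subset_span ⟨⟨d, hfl⟩, rfl⟩
    · simp only [IsFlagged, not_forall, not_le] at hfl
      obtain ⟨q, t, hq, ht⟩ := hfl
      have hcr := hc.crowded hq ht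
      have hst := slotPf_mem_span_of_crowded hA h2 hF (column r (chainOf d) q)
        (hc.column_injective q) hc.column_lt (min_le_right t r) hcr
      have hq0 : q ∈ Finset.range (chainOf d (2 * r) 0) :=
        Finset.mem_range.2 (hq.trans_le (hc.anti _ (Nat.zero_le t)))
      set g := ∏ q' ∈ (Finset.range (chainOf d (2 * r) 0)).erase q,
        slotPf (genSkew (2 * r) F) (column r (chainOf d) q') with hg
      have hgw := IsWeightedHomogeneous.prod ((Finset.range (chainOf d (2 * r) 0)).erase q)
        (fun q' => slotPf (genSkew (2 * r) F) (column r (chainOf d) q')) _ fun q' _ =>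
        isWeightedHomogeneous_slotPf (F := F) (2 * r) u (column r (chainOf d) q')
      rw [← hg] at hgw
      have hγ : ∑ p, u (column r (chainOf d) q p) +
          ∑ q' ∈ (Finset.range (chainOf d (2 * r) 0)).erase q,
            ∑ p, u (column r (chainOf d) q' p) = γ := by
        rw [← hd]
        exact Finset.add_sum_erase _ (fun q' => ∑ p, u (column r (chainOf d) q' p)) hq0
      rw [chainProd, ← Finset.mul_prod_erase _ _ hq0, map_mul, hslot, ← hg]
      refine (Submodule.span_le (p := M.comap (LinearMap.mulRight F (ψ g)))).2 ?_ hst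
      rintro _ ⟨K', rfl, hK', hlt⟩
      change slotPf A K' * ψ g ∈ M
      rw [← hslot, ← map_mul]
      refine ih _ ?_ _ ((isWeightedHomogeneous_slotPf (2 * r) u K').mul hgw)
      rw [← hγ]
      have h1 := hsum _ _ hK'
      have h2 := hsum _ (column r (chainOf d) q) hc.column_lt
      omega
  induction p using MvPolynomial.induction_on' with
  | monomial d a => exact main _ _ (isWeightedHomogeneous_monomial _ d a rfl)
  | add p q hp hq => rw [map_add]; exact M.add_mem hp hq

end FlaggedSpanning

section IsotropicRows

variable {R S : Type*} [CommRing R] [CommRing S]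

lemma sympForm_map (f : R →+* S) (r : ℕ) (P : ℕ → ℕ → R) (i j : ℕ) :
    f (sympForm r P i j) = sympForm r (fun t k => f (P t k)) i j := by
  simp [sympForm]

lemma slotPf_mul_mul {U : Type*} [Fintype U] [DecidableEq U] (A : ℕ → ℕ → R) (x : ℕ → R)
    (K : U × Fin 2 → ℕ) :
    slotPf (fun i j => x i * x j * A i j) K = (∏ p, x (K p)) * slotPf A K := by
  unfold slotPf
  rw [Finset.mul_sum]
  refine Finset.sum_congr rfl fun σ _ => ?_
  rw [Finset.prod_mul_distrib, ← Equiv.prod_comp σ fun p => x (K p), Fintype.prod_prod_type]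
  simp only [Fin.prod_univ_two]
  ring

lemma chainProd_mul_pow (r : ℕ) (c : ℕ → ℕ → ℕ) (A : ℕ → ℕ → R) (x : R) (w : ℕ → ℕ) :
    chainProd r c (fun i j => x ^ w i * x ^ w j * A i j) = x ^ chainWt r c w * chainProd r c A := by
  unfold chainProd chainWt
  simp only [slotPf_mul_mul, Finset.prod_mul_distrib, Finset.prod_pow_eq_pow_sum]

/-- If the rows of `P` are pairwise orthogonal for the symplectic form pairing the letters
`2 l` and `2 l + 1`, then the associated skew matrix is a nilpotent of square zero. -/
lemma isNullSkew_sympForm {r : ℕ} {P : ℕ → ℕ → R}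
    (h : ∀ t t', ∑ l ∈ Finset.range r,
      (P t (2 * l) * P t' (2 * l + 1) - P t (2 * l + 1) * P t' (2 * l)) = 0) :
    IsNullSkew r (sympForm r P) where
  skew i j := by
    unfold sympForm
    rw [← Finset.sum_neg_distrib]
    exact Finset.sum_congr rfl fun q _ => by ring
  diag i := Finset.sum_eq_zero fun q _ => by ring
  null i j := by
    have e : ∀ l, sympForm r P i (2 * l) * sympForm r P (2 * l + 1) j -
        sympForm r P i (2 * l + 1) * sympForm r P (2 * l) j =
        ∑ q : Fin r, ∑ q' : Fin r,
          (P (2 * q) i * P (2 * q' + 1) j *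
            (P (2 * q + 1) (2 * l) * P (2 * q') (2 * l + 1) -
              P (2 * q + 1) (2 * l + 1) * P (2 * q') (2 * l)) -
          P (2 * q) i * P (2 * q') j *
            (P (2 * q + 1) (2 * l) * P (2 * q' + 1) (2 * l + 1) -
              P (2 * q + 1) (2 * l + 1) * P (2 * q' + 1) (2 * l)) -
          P (2 * q + 1) i * P (2 * q' + 1) j *
            (P (2 * q) (2 * l) * P (2 * q') (2 * l + 1) -
              P (2 * q) (2 * l + 1) * P (2 * q') (2 * l)) +
          P (2 * q + 1) i * P (2 * q') j *
            (P (2 * q) (2 * l) * P (2 * q' + 1) (2 * l + 1) -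
              P (2 * q) (2 * l + 1) * P (2 * q' + 1) (2 * l))) := fun l => by
      unfold sympForm
      rw [Finset.sum_mul_sum, Finset.sum_mul_sum, ← Finset.sum_sub_distrib]
      refine Finset.sum_congr rfl fun q _ => ?_
      rw [← Finset.sum_sub_distrib]
      exact Finset.sum_congr rfl fun q' _ => by ring
    rw [Finset.sum_congr rfl fun l _ => e l, Finset.sum_comm]
    refine Finset.sum_eq_zero fun q _ => ?_
    rw [Finset.sum_comm]
    refine Finset.sum_eq_zero fun q' _ => ?_
    rw [Finset.sum_add_distrib, Finset.sum_sub_distrib, Finset.sum_sub_distrib]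
    simp only [← Finset.mul_sum, h]
    simp
  trace := by
    unfold sympForm
    rw [Finset.sum_comm]
    refine Finset.sum_eq_zero fun q _ => ?_
    rw [← h (2 * q) (2 * q + 1)]
    exact Finset.sum_congr rfl fun l _ => by ring

open Polynomial in
lemma linearIndependent_X_pow_mul {ι F K : Type*} [Field F] [Field K] [Algebra F K] (w : ι → ℕ)
    (b : ι → K[X]) (h : LinearIndependent F fun i => constantCoeff (b i)) :
    LinearIndependent F fun i => (X : K[X]) ^ w i * b i := by
  classical
  rw [linearIndependent_iff'] at h ⊢
  intro s g hs
  have main : ∀ n, ∀ i ∈ s, w i = n → g i = 0 := by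
    intro n
    induction n using Nat.strong_induction_on with
    | _ n ih =>
    intro i hi hw
    have hn := congrArg (fun p => coeff p n) hs
    simp only [finsetSum_coeff, coeff_smul, coeff_zero, coeff_X_pow_mul'] at hn
    have h0 : ∑ i ∈ s, (if w i = n then g i else 0) • constantCoeff (b i) = 0 := by
      rw [← hn]
      refine Finset.sum_congr rfl fun k hk => ?_
      rcases lt_trichotomy (w k) n with hlt | heq | hgt
      · rw [if_neg hlt.ne, ih _ hlt k hk rfl, zero_smul, zero_smul]
      · rw [if_pos heq, if_pos heq.le, heq, Nat.sub_self, constantCoeff_apply]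
      · rw [if_neg hgt.ne', if_neg (not_le.2 hgt), zero_smul, smul_zero]
    simpa [hw] using h s _ h0 i hi
  exact fun i hi => main _ i hi rfl

end IsotropicRows

section IsotropicFrame

open Polynomial

/-- The exponent by which the letter `j` is scaled in the degeneration of an isotropic frame. -/
def frameWt (j : ℕ) : ℕ := j % 2 * (j / 2)

/-- Every flagged frame is the limit of a one-parameter family of rescaled isotropic frames. -/
lemma exists_isotropic_frame {K : Type*} [Field K] (r : ℕ) (p : ℕ → ℕ → K)
    (hflag : ∀ t j, j / 2 < t → p t j = 0) (hout : ∀ t j, 2 * r ≤ j → p t j = 0)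
    (hdiag : ∀ t, t < r → p t (2 * t) ≠ 0) :
    ∃ Q : ℕ → ℕ → K[X], (∀ t j, constantCoeff (Q t j) = p t j) ∧
      (∀ t j, 2 * r ≤ j → Q t j = 0) ∧
      ∀ t t', ∑ l ∈ Finset.range r,
        (X ^ frameWt (2 * l) * Q t (2 * l) * (X ^ frameWt (2 * l + 1) * Q t' (2 * l + 1)) -
          X ^ frameWt (2 * l + 1) * Q t (2 * l + 1) * (X ^ frameWt (2 * l) * Q t' (2 * l))) =
        0 := by
  let G : Matrix (Fin r) (Fin r) K := Matrix.of fun t l => p t (2 * l)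
  let H : Matrix (Fin r) (Fin r) K := Matrix.of fun t l => p t (2 * l + 1)
  have hGt : G.BlockTriangular id := fun t l h => hflag _ _ (by simp at h; omega)
  have hHt : H.BlockTriangular id := fun t l h => hflag _ _ (by simp at h; omega)
  have hdet : G.det ≠ 0 := by
    rw [Matrix.det_of_isUpperTriangular hGt]
    exact Finset.prod_ne_zero_iff.2 fun l _ => hdiag l l.2
  have : Invertible G := Matrix.invertibleOfIsUnitDet G (isUnit_iff_ne_zero.2 hdet)
  let σ := G⁻¹ * H
  have hσt : σ.BlockTriangular id :=
    (Matrix.blockTriangular_inv_of_blockTriangular hGt).mul hHt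
  have hGσ : G * σ = H := by
    rw [← Matrix.mul_assoc, Matrix.mul_inv_of_invertible, Matrix.one_mul]
  let s : Fin r → Fin r → K := fun m l => σ (min m l) (max m l)
  have hs : ∀ m l, s m l = s l m := fun m l => by simp only [s, min_comm, max_comm]
  let Q : ℕ → ℕ → K[X] := fun t j =>
    if h : j < 2 * r then
      if j % 2 = 0 then C (p t j)
      else ∑ m : Fin r, C (p t (2 * m)) * (X ^ ((m : ℕ) - j / 2) * C (s m ⟨j / 2, by omega⟩))
    else 0
  have hQ0 : ∀ t (l : Fin r), Q t (2 * l) = C (p t (2 * l)) := fun t l => by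
    simp only [Q]
    rw [dif_pos (by omega), if_pos (by omega)]
  have hQ1 : ∀ t (l : Fin r), Q t (2 * l + 1) =
      ∑ m : Fin r, C (p t (2 * m)) * (X ^ ((m : ℕ) - l) * C (s m l)) := fun t l => by
    simp only [Q]
    rw [dif_pos (by omega), if_neg (by omega)]
    refine Finset.sum_congr rfl fun m _ => ?_
    have h1 : (2 * (l : ℕ) + 1) / 2 = l := by omega
    simp only [h1]
  refine ⟨Q, fun t j => ?_, fun t j hj => dif_neg (by omega), fun t t' => ?_⟩
  · by_cases hj : j < 2 * r
    · by_cases ht : t < r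
      · obtain ⟨l, rfl | rfl⟩ : ∃ l : Fin r, j = 2 * l ∨ j = 2 * l + 1 :=
          ⟨⟨j / 2, by omega⟩, by simp only; omega⟩
        · rw [hQ0, constantCoeff_apply, coeff_C_zero]
        · rw [hQ1, map_sum]
          have h1 : H ⟨t, ht⟩ l = p t (2 * l + 1) := rfl
          rw [← h1, ← hGσ, Matrix.mul_apply]
          refine Finset.sum_congr rfl fun m _ => ?_
          have h2 : G ⟨t, ht⟩ m = p t (2 * m) := rfl
          rw [h2]
          rcases le_or_gt m l with h | h
          · have h3 : (m : ℕ) - l = 0 := by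
              have : (m : ℕ) ≤ l := h
              omega
            simp [s, min_eq_left h, max_eq_right h, h3]
          · have h3 : (m : ℕ) - l ≠ 0 := by
              have : (l : ℕ) < m := h
              omega
            have h4 : σ m l = 0 := hσt h
            simp [h4, h3.symm]
      · have hz : ∀ k, p t k = 0 := fun k => by
          by_cases hk : 2 * r ≤ k
          · exact hout _ _ hk
          · exact hflag _ _ (by omega)
        simp [Q, hz]
    · rw [hout _ _ (by omega)]
      simp [Q, hj]
  · rw [Finset.sum_range (fun l => X ^ frameWt (2 * l) * Q t (2 * l) *
      (X ^ frameWt (2 * l + 1) * Q t' (2 * l + 1)) -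
      X ^ frameWt (2 * l + 1) * Q t (2 * l + 1) * (X ^ frameWt (2 * l) * Q t' (2 * l)))]
    have hw0 : ∀ l, frameWt (2 * l) = 0 := fun l => by simp [frameWt]
    have hw1 : ∀ l, frameWt (2 * l + 1) = l := fun l => by
      rw [frameWt, show (2 * l + 1) % 2 = 1 by omega, show (2 * l + 1) / 2 = l by omega, one_mul]
    have hP1 : ∀ t (l : Fin r), X ^ (l : ℕ) * Q t (2 * l + 1) =
        ∑ m : Fin r, C (p t (2 * m)) * (X ^ max (m : ℕ) l * C (s m l)) := fun t l => by
      rw [hQ1, Finset.mul_sum]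
      refine Finset.sum_congr rfl fun m _ => ?_
      rw [show max (m : ℕ) l = l + (m - l) by omega, pow_add]
      ring
    simp only [hw0, hw1, hP1, hQ0, pow_zero, one_mul]
    rw [Finset.sum_sub_distrib, sub_eq_zero]
    simp only [Finset.mul_sum, Finset.sum_mul]
    rw [Finset.sum_comm]
    refine Finset.sum_congr rfl fun m _ => Finset.sum_congr rfl fun l _ => ?_
    rw [hs, max_comm]
    ring

/-- A null skew matrix over a domain for which the flagged products of pfaffians are linearly
independent. -/
lemma exists_linearIndependent_chainProd {F : Type*} [Field F] (r : ℕ) (h2 : (2 : F) ≠ 0)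
    (hF : ∀ k, 0 < k → k ≤ r → (k : F) ≠ 0) :
    ∃ B : ℕ → ℕ → (FractionRing (MvPolynomial (Fin (2 * r) ×ₗ Fin (2 * r)) F))[X],
      IsNullSkew r B ∧ (∀ i j, 2 * r ≤ j → B i j = 0) ∧
      LinearIndependent F fun d : {d : Upper (2 * r) →₀ ℕ // IsFlagged r (chainOf d)} =>
        chainProd r (chainOf d.1) B := by
  let S := MvPolynomial (Fin (2 * r) ×ₗ Fin (2 * r)) F
  let K := FractionRing S
  let al : ℕ → ℕ → Prop := fun t j => t ≤ j / 2
  have hinj : Function.Injective (algebraMap S K) := IsFractionRing.injective S K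
  let p : ℕ → ℕ → K := fun t j => algebraMap S K (genP (2 * r) F al t j)
  obtain ⟨Q, hQ, hQout, hQiso⟩ := exists_isotropic_frame r p
    (fun t j h => by
      simp only [p]
      rw [genP, dif_neg (fun h' => absurd h'.2.2 (not_le.2 h)), map_zero])
    (fun t j h => by
      simp only [p]
      rw [genP_eq_zero h, map_zero])
    (fun t ht => by
      simp only [p]
      rw [genP, dif_pos ⟨by omega, by omega, show t ≤ 2 * t / 2 by omega⟩, ne_eq,
        map_eq_zero_iff _ hinj]
      exact MvPolynomial.X_ne_zero _)
  refine ⟨sympForm r fun t j => X ^ frameWt j * Q t j, isNullSkew_sympForm hQiso,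
    fun i j hj => ?_, ?_⟩
  · simp [sympForm, hQout _ _ hj]
  · have hB : (sympForm r fun t j => X ^ frameWt j * Q t j) = fun i j =>
        X ^ frameWt i * X ^ frameWt j * sympForm r Q i j := by
      funext i j
      unfold sympForm
      rw [Finset.mul_sum]
      exact Finset.sum_congr rfl fun q _ => by ring
    rw [hB]
    simp only [chainProd_mul_pow]
    refine linearIndependent_X_pow_mul _ _ ?_
    have hli := (linearIndependent_chainProd_sympForm (r := r) (F := F) al hF h2).map'
      (IsScalarTower.toAlgHom F S K).toLinearMap (LinearMap.ker_eq_bot.2 hinj)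
    suffices hfun : (fun d : {d : Upper (2 * r) →₀ ℕ // IsFlagged r (chainOf d)} =>
        constantCoeff (chainProd r (chainOf d.1) (sympForm r Q))) =
        (IsScalarTower.toAlgHom F S K).toLinearMap ∘ fun d =>
          chainProd r (chainOf d.1) (sympForm r (genP (2 * r) F al)) by
      rw [hfun]
      exact hli
    funext d
    simp only [chainProd_map, sympForm_map, hQ]
    exact (chainProd_map r _ _ (algebraMap S K)).trans (by simp only [sympForm_map, p]) |>.symm

end IsotropicFrame

section Coordinates

open Matrix

variable {R S : Type*} [CommRing R] [CommRing S] {r : ℕ}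

lemma forall_fin_two_mul {p : Fin (2 * r) → Prop} :
    (∀ a, p a) ↔ ∀ l, p (emb r l) ∧ p (embBar r l) := by
  refine ⟨fun h l => ⟨h _, h _⟩, fun h a => ?_⟩
  by_cases ha : (a : ℕ) < r
  · exact (h ⟨a, ha⟩).1
  · have h1 := (h ⟨a - r, by omega⟩).2
    have h2 : embBar r ⟨a - r, by omega⟩ = a := by
      ext
      simp only [embBar]
      omega
    rwa [h2] at h1

lemma sum_fin_two_mul {M : Type*} [AddCommMonoid M] (f : Fin (2 * r) → M) :
    ∑ a, f a = ∑ l, (f (emb r l) + f (embBar r l)) := by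
  have hr : 2 * r = r + r := two_mul r
  rw [← (finCongr hr.symm).sum_comp f, Fin.sum_univ_add, ← Finset.sum_add_distrib]
  rfl

lemma Jmat_emb_emb (k l : Fin r) : Jmat r R (emb r k) (emb r l) = 0 := by
  simp only [Jmat, emb, of_apply]
  rw [if_neg (by omega), if_neg (by omega)]

lemma Jmat_embBar_embBar (k l : Fin r) : Jmat r R (embBar r k) (embBar r l) = 0 := by
  simp only [Jmat, embBar, of_apply]
  rw [if_neg (by omega), if_neg (by omega)]

lemma Jmat_emb_embBar (k l : Fin r) :
    Jmat r R (emb r k) (embBar r l) = if k = l then 1 else 0 := by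
  simp only [Jmat, emb, embBar, of_apply, Fin.ext_iff]
  split_ifs <;> first | rfl | omega

lemma Jmat_embBar_emb (k l : Fin r) :
    Jmat r R (embBar r k) (emb r l) = if k = l then -1 else 0 := by
  simp only [Jmat, emb, embBar, of_apply, Fin.ext_iff]
  split_ifs <;> first | rfl | omega

lemma mul_Jmat_emb (M : Matrix (Fin (2 * r)) (Fin (2 * r)) R) (i : Fin (2 * r)) (l : Fin r) :
    (M * Jmat r R) i (emb r l) = - M i (embBar r l) := by
  rw [mul_apply, sum_fin_two_mul]
  simp [Jmat_emb_emb, Jmat_embBar_emb]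

lemma mul_Jmat_embBar (M : Matrix (Fin (2 * r)) (Fin (2 * r)) R) (i : Fin (2 * r)) (l : Fin r) :
    (M * Jmat r R) i (embBar r l) = M i (emb r l) := by
  rw [mul_apply, sum_fin_two_mul]
  simp [Jmat_emb_embBar, Jmat_embBar_embBar]

lemma mul_Jmat_mul_apply (M N : Matrix (Fin (2 * r)) (Fin (2 * r)) R) (i j : Fin (2 * r)) :
    (M * Jmat r R * N) i j =
      ∑ l, (M i (emb r l) * N (embBar r l) j - M i (embBar r l) * N (emb r l) j) := by
  rw [mul_apply, sum_fin_two_mul]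
  simp only [mul_Jmat_emb, mul_Jmat_embBar]
  exact Finset.sum_congr rfl fun l _ => by ring

lemma transpose_Jmat : (Jmat r R)ᵀ = - Jmat r R := by
  ext a b
  revert a b
  simp only [forall_fin_two_mul, transpose_apply, Matrix.neg_apply, Jmat_emb_emb,
    Jmat_embBar_emb, Jmat_emb_embBar, Jmat_embBar_embBar]
  refine fun k => ⟨fun l => ⟨?_, ?_⟩, fun l => ⟨?_, ?_⟩⟩ <;>
    by_cases h : k = l <;> simp [h, eq_comm (a := l)]

lemma Jmat_mul_Jmat : Jmat r R * Jmat r R = -1 := by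
  ext a b
  revert b
  simp only [forall_fin_two_mul, mul_Jmat_emb, mul_Jmat_embBar]
  revert a
  simp only [forall_fin_two_mul, Jmat_emb_emb, Jmat_embBar_emb, Jmat_emb_embBar,
    Jmat_embBar_embBar, Matrix.neg_apply, Matrix.one_apply]
  have h1 : ∀ k l, emb r k = emb r l ↔ k = l := fun k l => by simp [emb, Fin.ext_iff]
  have h2 : ∀ k l, embBar r k = embBar r l ↔ k = l := fun k l => by simp [embBar, Fin.ext_iff]
  have h3 : ∀ k l, emb r k ≠ embBar r l := fun k l => by
    simp only [emb, embBar, ne_eq, Fin.ext_iff]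
    omega
  simp only [h1, h2, h3, (h3 _ _).symm]
  refine fun k => ⟨fun l => ⟨?_, ?_⟩, fun l => ⟨?_, ?_⟩⟩ <;>
    by_cases h : k = l <;> simp [h]

lemma mapMatrix_Jmat (f : R →+* S) : f.mapMatrix (Jmat r R) = Jmat r S := by
  ext a b
  simp only [RingHom.mapMatrix_apply, map_apply, Jmat, of_apply]
  split_ifs <;> simp

/-- The position of a letter: `2 l` stands for `l` and `2 l + 1` for `r + l`. -/
def letterPos (r j : ℕ) (h : j < 2 * r) : Fin (2 * r) :=
  if j % 2 = 0 then emb r ⟨j / 2, by omega⟩ else embBar r ⟨j / 2, by omega⟩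

/-- The letter at a given position. -/
def posLetter (r : ℕ) (a : Fin (2 * r)) : ℕ := if (a : ℕ) < r then 2 * a else 2 * (a - r) + 1

lemma posLetter_emb (l : Fin r) : posLetter r (emb r l) = 2 * l := if_pos l.2

lemma posLetter_embBar (l : Fin r) : posLetter r (embBar r l) = 2 * l + 1 := by
  simp [posLetter, embBar]

lemma letterPos_even (l : Fin r) (h : 2 * (l : ℕ) < 2 * r) :
    letterPos r (2 * l) h = emb r l := by
  rw [letterPos, if_pos (by omega)]
  congr 1
  ext
  simp

lemma letterPos_odd (l : Fin r) (h : 2 * (l : ℕ) + 1 < 2 * r) :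
    letterPos r (2 * l + 1) h = embBar r l := by
  rw [letterPos, if_neg (by omega)]
  congr 1
  ext
  simp only
  omega

lemma posLetter_lt (a : Fin (2 * r)) : posLetter r a < 2 * r := by
  unfold posLetter
  split_ifs <;> omega

lemma letterPos_posLetter (a : Fin (2 * r)) : letterPos r (posLetter r a) (posLetter_lt a) = a := by
  revert a
  rw [forall_fin_two_mul]
  intro l
  constructor
  · simp only [posLetter_emb, letterPos_even]
  · simp only [posLetter_embBar, letterPos_odd]

lemma posLetter_letterPos {j : ℕ} (h : j < 2 * r) : posLetter r (letterPos r j h) = j := by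
  unfold letterPos
  split_ifs
  · rw [posLetter_emb]
    simp only
    omega
  · rw [posLetter_embBar]
    simp only
    omega

/-- A matrix as a function of pairs of letters, extended by zero. -/
def toLetters (M : Matrix (Fin (2 * r)) (Fin (2 * r)) R) (i j : ℕ) : R :=
  if h : i < 2 * r ∧ j < 2 * r then M (letterPos r i h.1) (letterPos r j h.2) else 0

/-- The matrix of a function of pairs of letters. -/
def ofLetters (r : ℕ) (B : ℕ → ℕ → R) : Matrix (Fin (2 * r)) (Fin (2 * r)) R :=
  of fun a b => B (posLetter r a) (posLetter r b)

lemma toLetters_of_lt (M : Matrix (Fin (2 * r)) (Fin (2 * r)) R) {i j : ℕ} (hi : i < 2 * r)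
    (hj : j < 2 * r) : toLetters M i j = M (letterPos r i hi) (letterPos r j hj) :=
  dif_pos ⟨hi, hj⟩

lemma toLetters_posLetter (M : Matrix (Fin (2 * r)) (Fin (2 * r)) R) (a b : Fin (2 * r)) :
    toLetters M (posLetter r a) (posLetter r b) = M a b := by
  rw [toLetters_of_lt M (posLetter_lt a) (posLetter_lt b), letterPos_posLetter,
    letterPos_posLetter]

lemma isNullSkew_toLetters {M : Matrix (Fin (2 * r)) (Fin (2 * r)) R} (hskew : Mᵀ = -M)
    (hdiag : ∀ i, M i i = 0) (hnull : M * Jmat r R * M = 0)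
    (htr : ∑ l, M (emb r l) (embBar r l) = 0) : IsNullSkew r (toLetters M) where
  skew i j := by
    by_cases h : i < 2 * r ∧ j < 2 * r
    · rw [toLetters_of_lt M h.1 h.2, toLetters_of_lt M h.2 h.1, ← Matrix.neg_apply, ← hskew,
        transpose_apply]
    · rw [toLetters, toLetters, dif_neg h, dif_neg (fun h' => h h'.symm), neg_zero]
  diag i := by
    by_cases h : i < 2 * r ∧ i < 2 * r
    · rw [toLetters_of_lt M h.1 h.2, hdiag]
    · rw [toLetters, dif_neg h]
  null i j := by
    by_cases h : i < 2 * r ∧ j < 2 * r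
    · rw [Finset.sum_range fun l => toLetters M i (2 * l) * toLetters M (2 * l + 1) j -
        toLetters M i (2 * l + 1) * toLetters M (2 * l) j]
      refine Eq.trans ?_ (congrFun (congrFun hnull (letterPos r i h.1)) (letterPos r j h.2))
      rw [mul_Jmat_mul_apply]
      refine Finset.sum_congr rfl fun l _ => ?_
      have h1 : 2 * (l : ℕ) < 2 * r := by omega
      have h2 : 2 * (l : ℕ) + 1 < 2 * r := by omega
      rw [toLetters_of_lt M h.1 h1, toLetters_of_lt M h.1 h2, toLetters_of_lt M h1 h.2,
        toLetters_of_lt M h2 h.2, letterPos_even, letterPos_odd]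
    · refine Finset.sum_eq_zero fun l _ => ?_
      rw [not_and_or] at h
      rcases h with h | h <;> simp [toLetters, h]
  trace := by
    rw [Finset.sum_range fun l => toLetters M (2 * l) (2 * l + 1), ← htr]
    refine Finset.sum_congr rfl fun l _ => ?_
    rw [← posLetter_embBar, ← posLetter_emb, toLetters_posLetter]

lemma transpose_ofLetters {B : ℕ → ℕ → R} (hB : IsNullSkew r B) :
    (ofLetters r B)ᵀ = - ofLetters r B := by
  ext a b
  exact hB.skew _ _

lemma ofLetters_mul_Jmat_mul {B : ℕ → ℕ → R} (hB : IsNullSkew r B) :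
    ofLetters r B * Jmat r R * ofLetters r B = 0 := by
  ext a b
  rw [mul_Jmat_mul_apply, Matrix.zero_apply, ← hB.null (posLetter r a) (posLetter r b),
    Finset.sum_range fun l => B (posLetter r a) (2 * l) * B (2 * l + 1) (posLetter r b) -
        B (posLetter r a) (2 * l + 1) * B (2 * l) (posLetter r b)]
  refine Finset.sum_congr rfl fun l _ => ?_
  simp only [ofLetters, of_apply, posLetter_emb, posLetter_embBar]

lemma toLetters_ofLetters {B : ℕ → ℕ → R} (hB : IsNullSkew r B)
    (hout : ∀ i j, 2 * r ≤ j → B i j = 0) : toLetters (ofLetters r B) = B := by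
  funext i j
  by_cases h : i < 2 * r ∧ j < 2 * r
  · rw [toLetters_of_lt _ h.1 h.2, ofLetters, of_apply, posLetter_letterPos, posLetter_letterPos]
  · rw [toLetters, dif_neg h]
    rcases not_and_or.1 h with h | h
    · rw [hB.skew, hout _ _ (not_lt.1 h), neg_zero]
    · rw [hout _ _ (not_lt.1 h)]

lemma toLetters_map (f : R →+* S) (M : Matrix (Fin (2 * r)) (Fin (2 * r)) R) (i j : ℕ) :
    f (toLetters M i j) = toLetters (f.mapMatrix M) i j := by
  unfold toLetters
  split_ifs
  · rfl
  · exact map_zero f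

end Coordinates

section CoordinateRing

open Matrix

variable {F : Type*} [Field F] {r : ℕ}

/-- The class of the generic matrix in `F[W]`. -/
def genW (r : ℕ) (F : Type*) [Field F] : Matrix (Fin (2 * r)) (Fin (2 * r)) (FW r F) :=
  (Ideal.Quotient.mk (WIdeal r F)).mapMatrix (Ygen r F)

lemma Jmat_mul_genW : Jmat r (FW r F) * (genW r F)ᵀ * Jmat r (FW r F) + genW r F = 0 := by
  have h : (Ideal.Quotient.mk (WIdeal r F)).mapMatrix
      (Jmat r (PolyRing r F) * (Ygen r F)ᵀ * Jmat r (PolyRing r F) + Ygen r F) = 0 := by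
    ext i j
    exact Ideal.Quotient.eq_zero_iff_mem.2 (Ideal.subset_span (Or.inl (Or.inl ⟨i, j, rfl⟩)))
  rw [map_add, map_mul, map_mul, mapMatrix_Jmat] at h
  exact h

lemma genW_mul_genW : genW r F * genW r F = 0 := by
  have h : (Ideal.Quotient.mk (WIdeal r F)).mapMatrix (Ygen r F * Ygen r F) = 0 := by
    ext i j
    exact Ideal.Quotient.eq_zero_iff_mem.2 (Ideal.subset_span (Or.inl (Or.inr ⟨i, j, rfl⟩)))
  rwa [map_mul] at h

lemma charpoly_genW : (genW r F).charpoly = Polynomial.X ^ (2 * r) := by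
  rw [← sub_eq_zero]
  ext k
  have h : Ideal.Quotient.mk (WIdeal r F)
      (((Ygen r F).charpoly - Polynomial.X ^ (2 * r)).coeff k) = 0 :=
    Ideal.Quotient.eq_zero_iff_mem.2 (Ideal.subset_span (Or.inr ⟨k, rfl⟩))
  rw [← Polynomial.coeff_map, Polynomial.map_sub, Polynomial.map_pow, Polynomial.map_X,
    ← Matrix.charpoly_map] at h
  exact h

lemma trace_genW : (genW r F).trace = 0 := by
  rcases Nat.eq_zero_or_pos r with rfl | hr
  · exact Finset.sum_eq_zero fun i _ => i.elim0
  · have : Nonempty (Fin (2 * r)) := ⟨⟨0, by omega⟩⟩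
    rw [Matrix.trace_eq_neg_charpoly_coeff, charpoly_genW, Fintype.card_fin,
      Polynomial.coeff_X_pow, if_neg (by omega), neg_zero]

/-- The skew matrix attached to the generic matrix of `F[W]`. -/
def skewW (r : ℕ) (F : Type*) [Field F] : Matrix (Fin (2 * r)) (Fin (2 * r)) (FW r F) :=
  genW r F * Jmat r (FW r F)

lemma skewW_mul_Jmat : skewW r F * Jmat r (FW r F) = - genW r F := by
  rw [skewW, Matrix.mul_assoc, Jmat_mul_Jmat, Matrix.mul_neg, Matrix.mul_one]

lemma transpose_skewW : (skewW r F)ᵀ = - skewW r F := by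
  have h := congrArg (· * Jmat r (FW r F)) (Jmat_mul_genW (r := r) (F := F))
  simp only [add_mul, zero_mul] at h
  rw [Matrix.mul_assoc _ (Jmat r (FW r F)) (Jmat r (FW r F)), Jmat_mul_Jmat, Matrix.mul_neg, Matrix.mul_one,
    neg_add_eq_zero] at h
  rw [skewW, transpose_mul, transpose_Jmat, Matrix.neg_mul, h]

lemma skewW_mul_Jmat_mul : skewW r F * Jmat r (FW r F) * skewW r F = 0 := by
  rw [skewW_mul_Jmat, skewW, Matrix.neg_mul, ← Matrix.mul_assoc, genW_mul_genW, zero_mul, neg_zero]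

lemma isNullSkew_skewW (h2 : (2 : F) ≠ 0) : IsNullSkew r (toLetters (skewW r F)) := by
  have hu : ∀ x : FW r F, x + x = 0 → x = 0 := fun x hx => by
    rw [← two_smul F] at hx
    have := congrArg (fun y => (2 : F)⁻¹ • y) hx
    simpa [smul_smul, inv_mul_cancel₀ h2] using this
  have hs : ∀ i j, skewW r F j i = - skewW r F i j := fun i j =>
    congrFun (congrFun (transpose_skewW (r := r) (F := F)) i) j
  refine isNullSkew_toLetters transpose_skewW (fun i => hu _ ?_) skewW_mul_Jmat_mul (hu _ ?_)
  · exact add_eq_zero_iff_eq_neg.2 (hs i i)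
  · have h : (-(skewW r F * Jmat r (FW r F))).trace = 0 := by
      rw [skewW_mul_Jmat, neg_neg, trace_genW]
    rw [trace_neg, neg_eq_zero, trace, sum_fin_two_mul] at h
    simp only [diag_apply, mul_Jmat_emb, mul_Jmat_embBar] at h
    rw [← neg_eq_zero, ← h, ← Finset.sum_add_distrib, ← Finset.sum_neg_distrib]
    refine Finset.sum_congr rfl fun l _ => ?_
    rw [hs (emb r l) (embBar r l)]
    ring

lemma toLetters_of_le {R : Type*} [CommRing R] (M : Matrix (Fin (2 * r)) (Fin (2 * r)) R)
    {i j : ℕ} (h : 2 * r ≤ j) : toLetters M i j = 0 := dif_neg (by omega)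

/-- The polynomial functions in the entries of the skew matrix exhaust `F[W]`. -/
lemma aeval_skewW_surjective (h2 : (2 : F) ≠ 0) : Function.Surjective
    (MvPolynomial.aeval (R := F)
      fun e : Upper (2 * r) => toLetters (skewW r F) e.1.1 e.1.2) := by
  set ψ := MvPolynomial.aeval (R := F)
    fun e : Upper (2 * r) => toLetters (skewW r F) e.1.1 e.1.2
  have hA := isNullSkew_skewW (r := r) h2
  have hmem : ∀ a b, skewW r F a b ∈ ψ.range := fun a b =>
    ⟨genSkew (2 * r) F (posLetter r a) (posLetter r b),
      (aeval_genSkew _ hA.skew hA.diag (fun i j h => toLetters_of_le _ h) _ _).trans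
        (toLetters_posLetter _ a b)⟩
  have hgen : ∀ a b, genW r F a b ∈ ψ.range := by
    intro a b
    have h : genW r F a b = -(skewW r F * Jmat r (FW r F)) a b := by
      rw [skewW_mul_Jmat, Matrix.neg_apply, neg_neg]
    rw [h]
    clear h
    revert b
    rw [forall_fin_two_mul]
    intro l
    rw [mul_Jmat_emb, mul_Jmat_embBar, neg_neg]
    exact ⟨hmem _ _, neg_mem (hmem _ _)⟩
  intro y
  obtain ⟨p, rfl⟩ := Ideal.Quotient.mk_surjective y
  change Ideal.Quotient.mk (WIdeal r F) p ∈ ψ.range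
  induction p using MvPolynomial.induction_on with
  | C a => exact ψ.range.algebraMap_mem a
  | add p q hp hq => rw [map_add]; exact add_mem hp hq
  | mul_X p i hp => rw [map_mul]; exact mul_mem hp (hgen i.1 i.2)

/-- A null skew matrix over a domain is a point of `W`. -/
lemma exists_algHom_skewW {S : Type*} [CommRing S] [IsDomain S] [Algebra F S] {B : ℕ → ℕ → S}
    (hB : IsNullSkew r B) (hout : ∀ i j, 2 * r ≤ j → B i j = 0) :
    ∃ φ : FW r F →ₐ[F] S, ∀ i j, φ (toLetters (skewW r F) i j) = B i j := by
  set M := ofLetters r B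
  have hM : Mᵀ = -M := transpose_ofLetters hB
  have hMJM : M * Jmat r S * M = 0 := ofLetters_mul_Jmat_mul hB
  set x := -(M * Jmat r S) with hx
  have hxx : x * x = 0 := by
    rw [hx, neg_mul_neg, ← Matrix.mul_assoc, hMJM, zero_mul]
  have hxJ : x * Jmat r S = M := by
    rw [hx, Matrix.neg_mul, Matrix.mul_assoc, Jmat_mul_Jmat, Matrix.mul_neg, Matrix.mul_one, neg_neg]
  have hJx : Jmat r S * xᵀ * Jmat r S + x = 0 := by
    have h : Jmat r S * xᵀ = x * Jmat r S := by
      rw [hxJ, hx, transpose_neg, transpose_mul, transpose_Jmat, hM, neg_mul_neg, mul_neg,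
        ← Matrix.mul_assoc, Jmat_mul_Jmat, Matrix.neg_mul, one_mul, neg_neg]
    rw [h, Matrix.mul_assoc, Jmat_mul_Jmat, Matrix.mul_neg, Matrix.mul_one, neg_add_cancel]
  have hchar : x.charpoly - Polynomial.X ^ (2 * r) = 0 := by
    have h := isNilpotent_charpoly_sub_pow_of_isNilpotent (M := x) ⟨2, by rw [pow_two, hxx]⟩
    rw [Fintype.card_fin] at h
    exact h.eq_zero
  let ev : PolyRing r F →ₐ[F] S := MvPolynomial.aeval fun ij => x ij.1 ij.2
  have hev : (ev : PolyRing r F →+* S).mapMatrix (Ygen r F) = x := by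
    ext i j
    exact MvPolynomial.aeval_X _ _
  have hker : ∀ p ∈ WIdeal r F, ev p = 0 := by
    intro p hp
    refine (Ideal.span_le (I := RingHom.ker (ev : PolyRing r F →+* S))).2 ?_ hp
    rintro _ ((⟨i, j, rfl⟩ | ⟨i, j, rfl⟩) | ⟨k, rfl⟩)
    · have h : (ev : PolyRing r F →+* S).mapMatrix
          (Jmat r (PolyRing r F) * (Ygen r F)ᵀ * Jmat r (PolyRing r F) + Ygen r F) = 0 := by
        rw [map_add, map_mul, map_mul, mapMatrix_Jmat, hev, ← hJx, ← hev]
        rfl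
      exact congrFun (congrFun h i) j
    · have h : (ev : PolyRing r F →+* S).mapMatrix (Ygen r F * Ygen r F) = 0 := by
        rw [map_mul, hev, hxx]
      exact congrFun (congrFun h i) j
    · change (ev : PolyRing r F →+* S) _ = 0
      rw [← Polynomial.coeff_map, Polynomial.map_sub, Polynomial.map_pow, Polynomial.map_X,
        ← Matrix.charpoly_map]
      change (((ev : PolyRing r F →+* S).mapMatrix (Ygen r F)).charpoly - _).coeff k = 0
      rw [hev, hchar, Polynomial.coeff_zero]
  refine ⟨Ideal.Quotient.liftₐ (WIdeal r F) ev hker, fun i j => ?_⟩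
  have h : ((Ideal.Quotient.liftₐ (WIdeal r F) ev hker : FW r F →ₐ[F] S) :
      FW r F →+* S).mapMatrix (skewW r F) = M := by
    rw [skewW, map_mul, mapMatrix_Jmat, ← hxJ, ← hev]
    rfl
  have h' := toLetters_map
    ((Ideal.Quotient.liftₐ (WIdeal r F) ev hker : FW r F →ₐ[F] S) : FW r F →+* S)
    (skewW r F) i j
  rw [h, toLetters_ofLetters hB hout] at h'
  exact h'

lemma isDomain_FW_of_ne_zero (h2 : (2 : F) ≠ 0) (hF : ∀ k, 0 < k → k ≤ r → (k : F) ≠ 0) :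
    IsDomain (FW r F) := by
  obtain ⟨B, hB, hout, hli⟩ := exists_linearIndependent_chainProd r h2 hF
  obtain ⟨φ, hφ⟩ := exists_algHom_skewW (F := F) hB hout
  refine Function.Injective.isDomain φ.toRingHom ((injective_iff_map_eq_zero φ).2 ?_)
  intro y hy
  obtain ⟨p, rfl⟩ := aeval_skewW_surjective h2 y
  have hp := aeval_mem_span_flagged (isNullSkew_skewW h2) (fun i j h => toLetters_of_le _ h)
    h2 hF p
  obtain ⟨a, ha⟩ := (Finsupp.mem_span_range_iff_exists_finsupp).1 hp
  have hz : (a.sum fun d c => c • chainProd r (chainOf d.1) B) = 0 := by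
    rw [← hy, ← ha, Finsupp.sum, Finsupp.sum, map_sum]
    refine Finset.sum_congr rfl fun d _ => ?_
    rw [map_smul]
    have h := chainProd_map r (chainOf d.1) (toLetters (skewW r F)) φ.toRingHom
    simp only [AlgHom.toRingHom_eq_coe, RingHom.coe_coe, hφ] at h
    rw [h]
  have ha0 := linearIndependent_iff.1 hli a hz
  rw [← ha, ha0, Finsupp.sum_zero_index]

lemma isDomain_FW_zero : IsDomain (FW 0 F) := by
  have h : WIdeal 0 F = ⊥ := by
    refine Ideal.span_eq_bot.2 ?_
    rintro _ ((⟨i, j, rfl⟩ | ⟨i, j, rfl⟩) | ⟨k, rfl⟩)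
    · exact i.elim0
    · exact i.elim0
    · simp [Matrix.charpoly, Matrix.det_isEmpty]
  have : (WIdeal 0 F).IsPrime := by
    rw [h]
    exact Ideal.isPrime_bot
  exact Ideal.Quotient.isDomain _

end CoordinateRing

/-- Let `n = 2r` be divisible by 4 and `F` a field with `char F = 0` or
`char F > r`. Then the coordinate ring `F[W]` is an integral domain. -/
theorem FW_isDomain (r : ℕ) (h4 : 4 ∣ 2 * r) (F : Type*) [Field F]
    (hchar : ringChar F = 0 ∨ r < ringChar F) :
    IsDomain (FW r F) := by
  rcases Nat.eq_zero_or_pos r with rfl | hr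
  · exact isDomain_FW_zero
  · have hF : ∀ k, 0 < k → k ≤ r → (k : F) ≠ 0 := by
      intro k h0 hk h
      have hd := (ringChar.spec F k).1 h
      rcases hchar with hc | hc
      · rw [hc, zero_dvd_iff] at hd
        omega
      · have := Nat.le_of_dvd h0 hd
        omega
    exact isDomain_FW_of_ne_zero (by exact_mod_cast hF 2 two_pos (by omega)) hF

end PR
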